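/- arXiv:1107.6004 — 3 statements merged into one kernel-verified Lean document; each statement's English description precedes it below -/
import Mathlib

section
/- Assume every entry of φ* is strictly positive, with smallest entry φ*_min. Let δ be positive tolerances, 0 < θ ≤ 1/2, and α ∈ (0,1); set θ₀″ = min(θ∞, α·θ/m) and assume θ₀″ < φ*_min. Then for every integer n ≥ 1: the set {f ∈ F_n ∩ C(δ) : ‖f − φ*‖₁ ≤ α·θ} has at least ⌊2nθ₀″/(m−1)⌋^{m−1} elements, and the set A'_n(δ,θ) = {f ∈ F_n ∩ C(δ) : ‖f − φ*‖₁ ≤ θ} satisfies #A'_n(δ,θ) ≥ ⌊2nθ₀″/(m−1)⌋^{m−1}·√(2π)·(m/(2π))^{m/2}·e^{−m/12}·n^{−(m−1)/2}·e^{n(H* − h(αθ))}, where h(x) = x·ln(m/x). -/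
open scoped Classical
open BigOperators Finset

/-- Minimum absolute value of the entries of a vector `b`. -/
noncomputable def bAbsMin {k : ℕ} (b : Fin (k + 1) → ℝ) : ℝ := ⨅ i, |b i|

/-- Matrix infinity norm: maximum over rows of the sum of absolute values. -/
noncomputable def rowNorm {k m : ℕ} (A : Matrix (Fin (k + 1)) (Fin m) ℝ) : ℝ :=
  ⨆ i, ∑ j, |A i j|

/-- `x` satisfies the constraints to accuracy `δ = (deq, dle, deq0, dle0)`,
i.e. `x ∈ C(δ)`. -/
def InC {m ke kle ke0 kle0 : ℕ}
    (Aeq : Matrix (Fin (ke + 1)) (Fin m) ℝ) (beq : Fin (ke + 1) → ℝ)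
    (Ale : Matrix (Fin (kle + 1)) (Fin m) ℝ) (ble : Fin (kle + 1) → ℝ)
    (Aeq0 : Matrix (Fin (ke0 + 1)) (Fin m) ℝ)
    (Ale0 : Matrix (Fin (kle0 + 1)) (Fin m) ℝ)
    (deq dle deq0 dle0 : ℝ) (x : Fin m → ℝ) : Prop :=
  (∀ i, |Aeq.mulVec x i - beq i| ≤ deq * bAbsMin beq) ∧
  (∀ i, Ale.mulVec x i - ble i ≤ dle * bAbsMin ble) ∧
  (∀ i, |Aeq0.mulVec x i| ≤ deq0) ∧
  (∀ i, Ale0.mulVec x i ≤ dle0)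

/-- `x` satisfies the constraints exactly. -/
def ExactSat {m ke kle ke0 kle0 : ℕ}
    (Aeq : Matrix (Fin (ke + 1)) (Fin m) ℝ) (beq : Fin (ke + 1) → ℝ)
    (Ale : Matrix (Fin (kle + 1)) (Fin m) ℝ) (ble : Fin (kle + 1) → ℝ)
    (Aeq0 : Matrix (Fin (ke0 + 1)) (Fin m) ℝ)
    (Ale0 : Matrix (Fin (kle0 + 1)) (Fin m) ℝ)
    (x : Fin m → ℝ) : Prop :=
  Aeq.mulVec x = beq ∧ (∀ i, Ale.mulVec x i ≤ ble i) ∧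
  Aeq0.mulVec x = 0 ∧ (∀ i, Ale0.mulVec x i ≤ 0)

/-- The tolerance `θ∞` of Proposition 2. -/
noncomputable def thetaInf {m ke kle ke0 kle0 : ℕ}
    (Aeq : Matrix (Fin (ke + 1)) (Fin m) ℝ) (beq : Fin (ke + 1) → ℝ)
    (Ale : Matrix (Fin (kle + 1)) (Fin m) ℝ) (ble : Fin (kle + 1) → ℝ)
    (Aeq0 : Matrix (Fin (ke0 + 1)) (Fin m) ℝ)
    (Ale0 : Matrix (Fin (kle0 + 1)) (Fin m) ℝ)
    (deq dle deq0 dle0 : ℝ) : ℝ :=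
  min (min (deq * bAbsMin beq / rowNorm Aeq) (dle * bAbsMin ble / rowNorm Ale))
      (min (deq0 / rowNorm Aeq0) (dle0 / rowNorm Ale0))

lemma aux_stirling {k : ℕ} (hk : 1 ≤ k) :
    Real.log (k.factorial : ℝ) ≤ k * Real.log k - k + Real.log k / 2 +
      Real.log (2 * Real.pi) / 2 + 1 / 12 := by
  have hpi := Real.pi_pos
  have h1 : Real.log (Stirling.stirlingSeq 1) - 1 / 12 ≤ Real.log (Real.sqrt Real.pi) := by
    have ht : Filter.Tendsto (fun n : ℕ => Real.log (Stirling.stirlingSeq (n + 1))) Filter.atTop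
        (nhds (Real.log (Real.sqrt Real.pi))) := by
      refine Filter.Tendsto.log ?_ (by positivity)
      exact Stirling.tendsto_stirlingSeq_sqrt_pi.comp (Filter.tendsto_add_atTop_nat 1)
    refine ge_of_tendsto' ht fun n => ?_
    have := Stirling.log_stirlingSeq_bounded_aux n
    norm_num at this ⊢
    linarith
  have h2 : Real.log (Stirling.stirlingSeq k) ≤ Real.log (Stirling.stirlingSeq 1) := by
    have := Stirling.log_stirlingSeq'_antitone (Nat.zero_le (k - 1))
    simp only [Function.comp] at this
    have e : (k - 1).succ = k := by omega
    rw [e] at this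
    exact this
  rw [Stirling.log_stirlingSeq_formula k] at h2
  have hk0 : (0 : ℝ) < k := by exact_mod_cast hk
  rw [Real.log_sqrt hpi.le] at h1
  rw [Real.log_div hk0.ne' (Real.exp_pos 1).ne', Real.log_exp,
    Real.log_mul two_ne_zero hk0.ne'] at h2
  rw [Real.log_mul two_ne_zero hpi.ne']
  linarith

lemma aux_multinomial {m n : ℕ} (hm : 1 ≤ m) (hn : 1 ≤ n) (ν : Fin m → ℕ)
    (hν : ∀ i, 1 ≤ ν i) (hs : ∑ i, ν i = n) :
    Real.sqrt (2 * Real.pi) *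
        ((m : ℝ) / (2 * Real.pi)) ^ ((m : ℝ) / 2) * Real.exp (-(m : ℝ) / 12) *
        (n : ℝ) ^ (-(((m : ℝ) - 1) / 2)) *
        Real.exp (n * (-∑ i, ((ν i : ℝ) / n) * Real.log ((ν i : ℝ) / n))) ≤
      (Nat.multinomial Finset.univ ν : ℝ) := by
  have hpi := Real.pi_pos
  have hm0 : (0 : ℝ) < m := by exact_mod_cast hm
  have hn0 : (0 : ℝ) < n := by exact_mod_cast hn
  have hν0 : ∀ i, (0 : ℝ) < ν i := fun i => by exact_mod_cast hν i
  have hsR : ∑ i, (ν i : ℝ) = n := by exact_mod_cast hs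
  have hM : (0 : ℝ) < (Nat.multinomial Finset.univ ν : ℝ) := by
    exact_mod_cast Nat.multinomial_pos _ _
  have hspec : (∑ i, Real.log ((ν i).factorial : ℝ)) +
      Real.log (Nat.multinomial Finset.univ ν : ℝ) = Real.log (n.factorial : ℝ) := by
    have h := Nat.multinomial_spec Finset.univ ν
    rw [hs] at h
    have h' : (∏ i, ((ν i).factorial : ℝ)) * (Nat.multinomial Finset.univ ν : ℝ)
        = (n.factorial : ℝ) := by exact_mod_cast h
    rw [← h', Real.log_mul _ hM.ne', Real.log_prod]
    · intro i _; exact_mod_cast (Nat.factorial_pos _).ne'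
    · exact (Finset.prod_pos fun i _ => by exact_mod_cast Nat.factorial_pos _).ne'
  have hlow := Stirling.le_log_factorial_stirling (n := n) (by omega)
  have hup : ∑ i, Real.log ((ν i).factorial : ℝ) ≤
      ∑ i, ((ν i : ℝ) * Real.log (ν i) - ν i + Real.log (ν i) / 2 +
      Real.log (2 * Real.pi) / 2 + 1 / 12) :=
    Finset.sum_le_sum fun i _ => aux_stirling (hν i)
  have hlog : ∑ i, Real.log (ν i : ℝ) ≤ m * (Real.log n - Real.log m) := by
    have h : ∀ i ∈ (Finset.univ : Finset (Fin m)), Real.log (ν i : ℝ) ≤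
        (ν i : ℝ) * (m / n) - 1 + (Real.log n - Real.log m) := by
      intro i _
      have := Real.log_le_sub_one_of_pos (x := (ν i : ℝ) * (m / n))
        (mul_pos (hν0 i) (div_pos hm0 hn0))
      rw [Real.log_mul (hν0 i).ne' (div_pos hm0 hn0).ne', Real.log_div hm0.ne' hn0.ne'] at this
      linarith
    refine (Finset.sum_le_sum h).trans ?_
    simp only [Finset.sum_add_distrib, Finset.sum_sub_distrib, ← Finset.sum_mul, hsR,
      Finset.sum_const, Finset.card_univ, Fintype.card_fin, nsmul_eq_mul]
    have : (n : ℝ) * (m / n) = m := by field_simp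
    linarith
  have hent : n * (-∑ i, ((ν i : ℝ) / n) * Real.log ((ν i : ℝ) / n)) =
      n * Real.log n - ∑ i, (ν i : ℝ) * Real.log (ν i) := by
    have : ∀ i, ((ν i : ℝ) / n) * Real.log ((ν i : ℝ) / n) =
        ((ν i : ℝ) * Real.log (ν i) - ν i * Real.log n) / n := by
      intro i
      rw [Real.log_div (hν0 i).ne' hn0.ne']; ring
    simp_rw [this]
    rw [← Finset.sum_div, Finset.sum_sub_distrib, ← Finset.sum_mul, hsR]
    field_simp
    ring
  simp only [Finset.sum_add_distrib, Finset.sum_sub_distrib, ← Finset.sum_div, hsR,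
      Finset.sum_const, Finset.card_univ, Fintype.card_fin, nsmul_eq_mul] at hup
  rw [hent, ← Real.log_le_log_iff (by positivity) hM, Real.log_mul (by positivity) (by positivity),
    Real.log_mul (by positivity) (by positivity), Real.log_mul (by positivity) (by positivity),
    Real.log_mul (by positivity) (by positivity), Real.log_exp, Real.log_exp,
    Real.log_rpow (by positivity), Real.log_rpow hn0, Real.log_sqrt (by positivity),
    Real.log_div hm0.ne' (by positivity)]
  nlinarith

lemma aux_entropy {a b t : ℝ} (ha : 0 < a) (hb : 0 < b) (hb1 : b ≤ 1)
    (ht : 0 < t) (ht4 : t ≤ 1 / 4) (hab : |b - a| ≤ t) :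
    b * Real.log b - a * Real.log a ≤ -(t * Real.log t) := by
  have hlt : Real.log t ≤ -1 := by
    rw [Real.log_le_iff_le_exp ht]
    have h := Real.exp_one_lt_d9
    have : (1 : ℝ) / 4 ≤ Real.exp (-1) := by
      rw [Real.exp_neg, one_div]
      exact inv_anti₀ (Real.exp_pos 1) (by linarith)
    linarith
  rcases le_or_gt a b with h | h
  · rw [abs_of_nonneg (by linarith)] at hab
    have h1 : a * (Real.log b - Real.log a) ≤ b - a := by
      have := Real.log_le_sub_one_of_pos (x := b / a) (by positivity)
      rw [Real.log_div hb.ne' ha.ne'] at this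
      calc _ ≤ a * (b / a - 1) := by gcongr
        _ = b - a := by field_simp
    have h2 : (b - a) * Real.log b ≤ 0 :=
      mul_nonpos_of_nonneg_of_nonpos (by linarith) (Real.log_nonpos hb.le hb1)
    nlinarith
  · rw [abs_of_neg (by linarith)] at hab
    obtain ⟨d, rfl⟩ : ∃ d, a = b + d := ⟨a - b, by ring⟩
    have hd : 0 < d := by linarith
    have hdt : d ≤ t := by linarith
    have h1 : b * Real.log b ≤ b * Real.log (b + d) := by gcongr
    have h2 : d * Real.log d ≤ d * Real.log (b + d) := by gcongr; linarith
    have h3 : d * (Real.log t - Real.log d) ≤ t - d := by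
      have := Real.log_le_sub_one_of_pos (x := t / d) (by positivity)
      rw [Real.log_div ht.ne' hd.ne'] at this
      calc _ ≤ d * (t / d - 1) := by gcongr
        _ = t - d := by field_simp
    nlinarith

lemma aux_box {k n : ℕ} (hk : 1 ≤ k) (hn : 1 ≤ n) (φ : Fin (k + 1) → ℝ) (hφ1 : ∑ i, φ i = 1)
    (t : ℝ) (ht : ∀ i, t < φ i) :
    ⌊2 * (n : ℝ) * t / k⌋₊ ^ k ≤ ((Finset.Nat.antidiagonalTuple (k + 1) n).filter
      (fun ν => ∀ i, |(ν i : ℝ) / n - φ i| ≤ t)).card := by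
  have hn0 : (0 : ℝ) < n := by exact_mod_cast hn
  have hk0 : (0 : ℝ) < k := by exact_mod_cast hk
  have hk1 : (1 : ℝ) ≤ k := by exact_mod_cast hk
  set L := ⌊2 * (n : ℝ) * t / k⌋₊ with hL
  rcases Nat.eq_zero_or_pos L with h0 | hLpos
  · rw [h0, zero_pow (by omega)]; exact Nat.zero_le _
  have hq : 1 ≤ 2 * (n : ℝ) * t / k := by
    by_contra hcon
    have : L = 0 := Nat.floor_eq_zero.2 (not_le.1 hcon)
    omega
  have hLle : (L : ℝ) ≤ 2 * (n : ℝ) * t / k := Nat.floor_le (by linarith)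
  set s : ℝ := n * t / k with hs
  have hs2 : 2 * (n : ℝ) * t / k = 2 * s := by rw [hs]; ring
  have hks : (k : ℝ) * s = n * t := by rw [hs]; field_simp
  have hspos : 0 < s := by linarith
  have hst : s ≤ n * t := by nlinarith
  let c : Fin k → ℕ := fun i => ⌈n * φ i.castSucc - s⌉₊
  have hc1 : ∀ i, n * φ i.castSucc - s ≤ c i := fun i => Nat.le_ceil _
  have hc2 : ∀ i, (c i : ℝ) < n * φ i.castSucc - s + 1 := fun i => by
    apply Nat.ceil_lt_add_one
    have := mul_lt_mul_of_pos_left (ht i.castSucc) hn0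
    linarith
  have key : ∀ g ∈ Fintype.piFinset (fun _ : Fin k => Finset.range L),
      ∀ i, |((c i + g i : ℕ) : ℝ) - n * φ i.castSucc| ≤ s := by
    intro g hg i
    have hgi : g i + 1 ≤ L := Finset.mem_range.1 (Fintype.mem_piFinset.1 hg i)
    have hgi' : (g i : ℝ) + 1 ≤ L := by exact_mod_cast hgi
    have := hc1 i
    have := hc2 i
    have : (0 : ℝ) ≤ g i := Nat.cast_nonneg _
    push_cast
    rw [abs_le]
    constructor <;> linarith
  have hφs : ∑ i : Fin k, φ i.castSucc = 1 - φ (Fin.last k) := by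
    rw [Fin.sum_univ_castSucc] at hφ1; linarith
  have keysum : ∀ g ∈ Fintype.piFinset (fun _ : Fin k => Finset.range L),
      |((∑ i, (c i + g i) : ℕ) : ℝ) - n * (1 - φ (Fin.last k))| ≤ n * t := by
    intro g hg
    rw [← hφs, Nat.cast_sum, Finset.mul_sum, ← Finset.sum_sub_distrib]
    refine (Finset.abs_sum_le_sum_abs _ _).trans ?_
    refine (Finset.sum_le_sum fun i _ => key g hg i).trans ?_
    simp [hks]
  have keyle : ∀ g ∈ Fintype.piFinset (fun _ : Fin k => Finset.range L),
      ∑ i, (c i + g i) ≤ n := by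
    intro g hg
    have h1 := (abs_le.1 (keysum g hg)).2
    have := mul_lt_mul_of_pos_left (ht (Fin.last k)) hn0
    have h3 : ((∑ i, (c i + g i) : ℕ) : ℝ) ≤ n := by linarith
    exact_mod_cast h3
  have hcard : (Fintype.piFinset (fun _ : Fin k => Finset.range L)).card = L ^ k := by simp
  rw [← hcard]
  refine Finset.card_le_card_of_injOn
    (fun g => Fin.snoc (α := fun _ => ℕ) (fun i => c i + g i) (n - ∑ i, (c i + g i))) ?_ ?_
  · intro g hg
    have hg' : g ∈ Fintype.piFinset (fun _ : Fin k => Finset.range L) := hg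
    simp only [Finset.coe_filter, Set.mem_setOf_eq, Finset.Nat.mem_antidiagonalTuple]
    have hdiv : ∀ x y r : ℝ, |x - n * y| ≤ n * r → |x / n - y| ≤ r := by
      intro x y r h
      have e : x / n - y = (x - n * y) / n := by field_simp
      rw [e, abs_div, abs_of_pos hn0, div_le_iff₀ hn0]
      linarith
    refine ⟨?_, ?_⟩
    · rw [Fin.sum_univ_castSucc]
      simp only [Fin.snoc_castSucc, Fin.snoc_last]
      have := keyle g hg'
      omega
    · intro i
      refine Fin.lastCases ?_ (fun i => ?_) i
      · simp only [Fin.snoc_last]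
        apply hdiv
        rw [Nat.cast_sub (keyle g hg')]
        have := keysum g hg'
        rw [abs_sub_comm] at this
        convert this using 2
        ring
      · simp only [Fin.snoc_castSucc]
        exact hdiv _ _ _ ((key g hg' i).trans hst)
  · intro g _ g' _ h
    funext i
    have := congrFun h i.castSucc
    simp only [Fin.snoc_castSucc] at this
    omega

lemma aux_row {k m : ℕ} (A : Matrix (Fin (k + 1)) (Fin m) ℝ) (hA : A ≠ 0) (φ x : Fin m → ℝ)
    (t d : ℝ) (ht : t ≤ d / rowNorm A) (hx : ∀ i, |x i - φ i| ≤ t) (ht0 : 0 ≤ t) (i : Fin (k + 1)) :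
    |A.mulVec x i - A.mulVec φ i| ≤ d := by
  have hle : ∀ i, ∑ j, |A i j| ≤ rowNorm A := fun i =>
    le_ciSup (f := fun i => ∑ j, |A i j|) (Set.finite_range _).bddAbove i
  have hpos : 0 < rowNorm A := by
    by_contra hcon
    apply hA
    ext i j
    have h1 : |A i j| ≤ ∑ j, |A i j| :=
      Finset.single_le_sum (f := fun j => |A i j|) (fun _ _ => abs_nonneg _) (Finset.mem_univ j)
    have h2 := hle i
    have : |A i j| ≤ 0 := by linarith
    simpa using this
  rw [le_div_iff₀ hpos] at ht
  have e : A.mulVec x i - A.mulVec φ i = ∑ j, A i j * (x j - φ j) := by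
    simp [Matrix.mulVec, dotProduct, mul_sub, Finset.sum_sub_distrib]
  rw [e]
  calc |∑ j, A i j * (x j - φ j)| ≤ ∑ j, |A i j * (x j - φ j)| := Finset.abs_sum_le_sum_abs _ _
    _ ≤ ∑ j, |A i j| * t := by
      refine Finset.sum_le_sum fun j _ => ?_
      rw [abs_mul]
      exact mul_le_mul_of_nonneg_left (hx j) (abs_nonneg _)
    _ = t * ∑ j, |A i j| := by rw [← Finset.sum_mul, mul_comm]
    _ ≤ t * rowNorm A := mul_le_mul_of_nonneg_left (hle i) ht0
    _ ≤ d := ht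

/-- ℓ1 analogue of the lower bounds (Lemma `le:nrAn1` of the paper,
with `μ* = m`): with `θ₀″ = min(θ∞, αθ/m) < φ*_min`, the set of `f ∈ F_n ∩ C(δ)`
with `‖f − φ*‖₁ ≤ αθ` has at least `⌊2nθ₀″/(m−1)⌋^{m−1}` elements, and the number of
realizations of `A'_n(δ,θ) = {f ∈ F_n ∩ C(δ) : ‖f − φ*‖₁ ≤ θ}` is at least
`⌊2nθ₀″/(m−1)⌋^{m−1}·√(2π)·(m/(2π))^{m/2}·e^{−m/12}·n^{−(m−1)/2}·e^{n(H*−h(αθ))}`,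
where `h(x) = x·ln(m/x)`. -/
theorem stmt_15 {m ke kle ke0 kle0 : ℕ} (hm : 2 ≤ m)
    (Aeq : Matrix (Fin (ke + 1)) (Fin m) ℝ) (beq : Fin (ke + 1) → ℝ)
    (Ale : Matrix (Fin (kle + 1)) (Fin m) ℝ) (ble : Fin (kle + 1) → ℝ)
    (Aeq0 : Matrix (Fin (ke0 + 1)) (Fin m) ℝ)
    (Ale0 : Matrix (Fin (kle0 + 1)) (Fin m) ℝ)
    (hAeq : Aeq ≠ 0) (hAle : Ale ≠ 0) (hAeq0 : Aeq0 ≠ 0) (hAle0 : Ale0 ≠ 0)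
    (hbeq : ∀ i, beq i ≠ 0) (hble : ∀ i, ble i ≠ 0)
    (deq dle deq0 dle0 : ℝ)
    (hdeq : 0 < deq) (hdle : 0 < dle) (hdeq0 : 0 < deq0) (hdle0 : 0 < dle0)
    (φ : Fin m → ℝ) (hφpos : ∀ i, 0 < φ i) (hφ1 : ∑ i, φ i = 1)
    (hsat : ExactSat Aeq beq Ale ble Aeq0 Ale0 φ)
    (hopt : ∀ x : Fin m → ℝ, (∀ i, 0 ≤ x i) → ∑ i, x i = 1 →
      ExactSat Aeq beq Ale ble Aeq0 Ale0 x →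
      -∑ i, x i * Real.log (x i) ≤ -∑ i, φ i * Real.log (φ i))
    (Hs : ℝ) (hHs : Hs = -∑ i, φ i * Real.log (φ i))
    (φmin : ℝ) (hφmin : (∃ i, φ i = φmin) ∧ ∀ i, φmin ≤ φ i)
    (θ : ℝ) (hθ0 : 0 < θ) (hθ : θ ≤ 1 / 2)
    (α : ℝ) (hα : α ∈ Set.Ioo (0 : ℝ) 1)
    (θ₀ : ℝ)
    (hθ₀ : θ₀ = min (thetaInf Aeq beq Ale ble Aeq0 Ale0 deq dle deq0 dle0)
        (α * θ / m))
    (hθ₀lt : θ₀ < φmin)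
    (n : ℕ) (hn : 1 ≤ n) :
    ⌊2 * (n : ℝ) * θ₀ / ((m : ℝ) - 1)⌋₊ ^ (m - 1) ≤
      ((Finset.Nat.antidiagonalTuple m n).filter
        (fun ν => InC Aeq beq Ale ble Aeq0 Ale0 deq dle deq0 dle0
            (fun i => (ν i : ℝ) / n) ∧
          (∑ i, |(ν i : ℝ) / n - φ i|) ≤ α * θ)).card ∧
    (⌊2 * (n : ℝ) * θ₀ / ((m : ℝ) - 1)⌋₊ ^ (m - 1) : ℝ) * Real.sqrt (2 * Real.pi) *
        ((m : ℝ) / (2 * Real.pi)) ^ ((m : ℝ) / 2) * Real.exp (-(m : ℝ) / 12) *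
        (n : ℝ) ^ (-(((m : ℝ) - 1) / 2)) *
        Real.exp (n * (Hs - α * θ * Real.log ((m : ℝ) / (α * θ)))) ≤
      ∑ ν ∈ (Finset.Nat.antidiagonalTuple m n).filter
        (fun ν => InC Aeq beq Ale ble Aeq0 Ale0 deq dle deq0 dle0
            (fun i => (ν i : ℝ) / n) ∧
          (∑ i, |(ν i : ℝ) / n - φ i|) ≤ θ),
        (Nat.multinomial Finset.univ ν : ℝ) := by
  obtain ⟨k, rfl⟩ : ∃ k, m = k + 1 := ⟨m - 1, by omega⟩
  obtain ⟨hα0, hα1⟩ := hα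
  have hn0 : (0 : ℝ) < n := by exact_mod_cast hn
  have hm2 : (2 : ℝ) ≤ ((k + 1 : ℕ) : ℝ) := by exact_mod_cast hm
  have hm0 : (0 : ℝ) < ((k + 1 : ℕ) : ℝ) := by linarith
  have hkcast : ((k + 1 : ℕ) : ℝ) - 1 = k := by push_cast; ring
  have hαθ : 0 < α * θ := mul_pos hα0 hθ0
  have hαθ' : α * θ ≤ 1 / 2 := by nlinarith
  set B := (Finset.Nat.antidiagonalTuple (k + 1) n).filter
      (fun ν => ∀ i, |(ν i : ℝ) / n - φ i| ≤ θ₀) with hB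
  have hbox : ⌊2 * (n : ℝ) * θ₀ / (((k + 1 : ℕ) : ℝ) - 1)⌋₊ ^ (k + 1 - 1) ≤ B.card := by
    rw [hkcast, Nat.add_sub_cancel]
    exact aux_box (by omega) hn φ hφ1 θ₀ (fun i => hθ₀lt.trans_le (hφmin.2 i))
  have hle1 : θ₀ ≤ thetaInf Aeq beq Ale ble Aeq0 Ale0 deq dle deq0 dle0 := by
    rw [hθ₀]; exact min_le_left _ _
  have hle2 : θ₀ ≤ α * θ / ((k + 1 : ℕ) : ℝ) := by
    rw [hθ₀]; exact min_le_right _ _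
  have hsub : B ⊆ (Finset.Nat.antidiagonalTuple (k + 1) n).filter
        (fun ν => InC Aeq beq Ale ble Aeq0 Ale0 deq dle deq0 dle0
            (fun i => (ν i : ℝ) / n) ∧
          (∑ i, |(ν i : ℝ) / n - φ i|) ≤ α * θ) := by
    intro ν hν
    rw [hB, Finset.mem_filter] at hν
    obtain ⟨hν1, hν2⟩ := hν
    rw [Finset.mem_filter]
    have h0 : 0 ≤ θ₀ := (abs_nonneg _).trans (hν2 0)
    unfold thetaInf at hle1
    simp only [le_min_iff] at hle1
    obtain ⟨⟨r1, r2⟩, r3, r4⟩ := hle1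
    obtain ⟨s1, s2, s3, s4⟩ := hsat
    refine ⟨hν1, ⟨?_, ?_, ?_, ?_⟩, ?_⟩
    · intro i
      have := aux_row Aeq hAeq φ (fun i => (ν i : ℝ) / n) θ₀ _ r1 hν2 h0 i
      rwa [s1] at this
    · intro i
      have := (abs_le.1 (aux_row Ale hAle φ (fun i => (ν i : ℝ) / n) θ₀ _ r2 hν2 h0 i)).2
      have := s2 i
      linarith
    · intro i
      have := aux_row Aeq0 hAeq0 φ (fun i => (ν i : ℝ) / n) θ₀ _ r3 hν2 h0 i
      rw [s3] at this
      simpa using this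
    · intro i
      have := (abs_le.1 (aux_row Ale0 hAle0 φ (fun i => (ν i : ℝ) / n) θ₀ _ r4 hν2 h0 i)).2
      have := s4 i
      linarith
    · refine (Finset.sum_le_sum fun i _ => hν2 i).trans ?_
      rw [Finset.sum_const, Finset.card_univ, Fintype.card_fin, nsmul_eq_mul]
      rw [le_div_iff₀ hm0] at hle2
      linarith
  refine ⟨hbox.trans (Finset.card_le_card hsub), ?_⟩
  have hsub2 : B ⊆ (Finset.Nat.antidiagonalTuple (k + 1) n).filter
        (fun ν => InC Aeq beq Ale ble Aeq0 Ale0 deq dle deq0 dle0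
            (fun i => (ν i : ℝ) / n) ∧
          (∑ i, |(ν i : ℝ) / n - φ i|) ≤ θ) := by
    intro ν hν
    have := hsub hν
    rw [Finset.mem_filter] at this ⊢
    refine ⟨this.1, this.2.1, this.2.2.trans ?_⟩
    nlinarith
  refine le_trans ?_ (Finset.sum_le_sum_of_subset_of_nonneg hsub2 fun _ _ _ => Nat.cast_nonneg _)
  set K : ℝ := Real.sqrt (2 * Real.pi) *
        (((k + 1 : ℕ) : ℝ) / (2 * Real.pi)) ^ (((k + 1 : ℕ) : ℝ) / 2) *
        Real.exp (-((k + 1 : ℕ) : ℝ) / 12) *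
        (n : ℝ) ^ (-((((k + 1 : ℕ) : ℝ) - 1) / 2)) with hK
  have hK0 : 0 ≤ K := by have := Real.pi_pos; positivity
  set E : ℝ := Real.exp (n * (Hs - α * θ * Real.log (((k + 1 : ℕ) : ℝ) / (α * θ)))) with hE
  have hpt : ∀ ν ∈ B, K * E ≤ (Nat.multinomial Finset.univ ν : ℝ) := by
    intro ν hν
    rw [hB, Finset.mem_filter, Finset.Nat.mem_antidiagonalTuple] at hν
    obtain ⟨hν1, hν2⟩ := hν
    have hνpos : ∀ i, 0 < (ν i : ℝ) / n := by
      intro i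
      have h1 := (abs_le.1 (hν2 i)).1
      have h2 := hφmin.2 i
      linarith
    have hνge : ∀ i, 1 ≤ ν i := by
      intro i
      rcases Nat.eq_zero_or_pos (ν i) with h | h
      · have := hνpos i
        simp [h] at this
      · exact h
    refine le_trans ?_ (aux_multinomial (by omega) hn ν hνge hν1)
    refine mul_le_mul_of_nonneg_left ?_ hK0
    rw [hE, Real.exp_le_exp]
    refine mul_le_mul_of_nonneg_left ?_ hn0.le
    set t := α * θ / ((k + 1 : ℕ) : ℝ) with htdef
    have ht0 : 0 < t := div_pos hαθ hm0
    have ht4 : t ≤ 1 / 4 := by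
      rw [htdef, div_le_iff₀ hm0]; linarith
    have hent : ∀ i ∈ (Finset.univ : Finset (Fin (k + 1))),
        ((ν i : ℝ) / n) * Real.log ((ν i : ℝ) / n) ≤
        φ i * Real.log (φ i) + -(t * Real.log t) := by
      intro i _
      have hle : (ν i : ℝ) / n ≤ 1 := by
        rw [div_le_one hn0]
        have : ν i ≤ n := by
          rw [← hν1]
          exact Finset.single_le_sum (f := ν) (fun _ _ => Nat.zero_le _) (Finset.mem_univ i)
        exact_mod_cast this
      have := aux_entropy (hφpos i) (hνpos i) hle ht0 ht4 ((hν2 i).trans hle2)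
      linarith
    have hsum := Finset.sum_le_sum hent
    rw [Finset.sum_add_distrib, Finset.sum_const, Finset.card_univ, Fintype.card_fin,
      nsmul_eq_mul] at hsum
    have e : ((k + 1 : ℕ) : ℝ) * -(t * Real.log t) =
        α * θ * Real.log (((k + 1 : ℕ) : ℝ) / (α * θ)) := by
      have e1 : ((k + 1 : ℕ) : ℝ) / (α * θ) = t⁻¹ := by rw [htdef, inv_div]
      have e2 : ((k + 1 : ℕ) : ℝ) * t = α * θ := by rw [htdef]; field_simp
      rw [e1, Real.log_inv, ← e2]; ring
    rw [e] at hsum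
    rw [hHs]
    linarith
  have hfin := Finset.card_nsmul_le_sum B _ _ hpt
  rw [nsmul_eq_mul] at hfin
  refine le_trans ?_ hfin
  have hboxR : ((⌊2 * (n : ℝ) * θ₀ / (((k + 1 : ℕ) : ℝ) - 1)⌋₊ : ℝ)) ^ (k + 1 - 1) ≤ B.card := by
    exact_mod_cast hbox
  calc _ = ((⌊2 * (n : ℝ) * θ₀ / (((k + 1 : ℕ) : ℝ) - 1)⌋₊ : ℝ)) ^ (k + 1 - 1) * (K * E) := by
        rw [hK]; ring
    _ ≤ _ := mul_le_mul_of_nonneg_right hboxR (mul_nonneg hK0 (Real.exp_pos _).le)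
end

section
/- Assume every entry of φ* is strictly positive, with smallest entry φ*_min, and let C₀ denote the (convex) set of probability vectors satisfying the constraints exactly. Let δ be positive tolerances, ε > 0, 0 < θ ≤ 1/2, and α ∈ (0,1) with ψ(α,θ) = θ²/2 − α·θ·ln(m/(α·θ)) > 0; set θ₀″ = min(θ∞, α·θ/m) and assume θ₀″ < φ*_min. Define C₁ = (m−1)/ψ(α,θ) and C₂ = (m·ln 0.6 + (0.5·ln(2π) + 1/12 − 0.5·ln m)·m + ln((1/ε + 1)/0.249))/ψ(α,θ). Then for every integer n with n ≥ 100, n ≥ C₁·ln n + C₂, and n ≥ (m−1)/(2θ₀″): #A/(#A + #B) ≥ 1 − ε, where A = {f ∈ F_n ∩ C(δ) : ‖f − φ*‖₁ ≤ θ} and B = {f ∈ F_n ∩ C₀ : ‖f − φ*‖₁ > θ}. -/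
open scoped Classical
open BigOperators Finset

lemma aux_hoeff (p l : ℝ) (h0 : 0 ≤ p) (h1 : p ≤ 1) :
    (1 - p) + p * Real.exp l ≤ Real.exp (p * l + l ^ 2 / 8) := by
  let μ : MeasureTheory.Measure ℝ := ENNReal.ofReal (1 - p) • MeasureTheory.Measure.dirac 0 +
    ENNReal.ofReal p • MeasureTheory.Measure.dirac 1
  have hμ : MeasureTheory.IsProbabilityMeasure μ := ⟨by
    simp only [μ, MeasureTheory.Measure.add_apply, MeasureTheory.Measure.smul_apply, smul_eq_mul,
      MeasureTheory.measure_univ, mul_one]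
    rw [← ENNReal.ofReal_add (by linarith) h0]; simp⟩
  have hintegral : ∀ f : ℝ → ℝ, ∫ x, f x ∂μ = (1 - p) * f 0 + p * f 1 := by
    intro f
    have hi : ∀ (c : ℝ) (a : ℝ), MeasureTheory.Integrable f
        (ENNReal.ofReal c • MeasureTheory.Measure.dirac a) := fun c a =>
      (MeasureTheory.integrable_dirac (by simp)).smul_measure ENNReal.ofReal_ne_top
    rw [MeasureTheory.integral_add_measure (hi _ _) (hi _ _)]
    simp [MeasureTheory.integral_smul_measure, ENNReal.toReal_ofReal, h0, h1]
  have h := ProbabilityTheory.hasSubgaussianMGF_of_mem_Icc (μ := μ) (X := fun x : ℝ => x) (a := 0)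
    (b := 1) measurable_id.aemeasurable (by
      simp only [μ]
      rw [MeasureTheory.ae_add_measure_iff]
      constructor <;> apply MeasureTheory.Measure.ae_smul_measure <;>
        exact (MeasureTheory.ae_dirac_iff (measurableSet_Icc (a := (0:ℝ)) (b := 1))).mpr (by simp))
  have h2 := h.mgf_le l
  rw [ProbabilityTheory.mgf, hintegral, hintegral] at h2
  simp at h2
  have e1 : Real.exp (p * l + l ^ 2 / 8) = Real.exp (p * l) * Real.exp ((2 ^ 2)⁻¹ * l ^ 2 / 2) := by
    rw [← Real.exp_add]; congr 1; ring
  rw [e1]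
  refine le_trans (le_of_eq ?_) (mul_le_mul_of_nonneg_left h2 (Real.exp_pos _).le)
  have e2 : Real.exp (l * (1 - p)) = Real.exp l * Real.exp (-(p * l)) := by
    rw [← Real.exp_add]; congr 1; ring
  have e3 : Real.exp (-(l * p)) = Real.exp (-(p * l)) := by congr 1; ring
  rw [e2, e3]
  have e4 : Real.exp (p * l) * Real.exp (-(p * l)) = 1 := by rw [← Real.exp_add]; simp
  linear_combination (-(1 - p) - p * Real.exp l) * e4

lemma aux_multi {m : ℕ} (n : ℕ) (x : Fin m → ℝ) :
    ∑ ν ∈ Finset.Nat.antidiagonalTuple m n, (Nat.multinomial Finset.univ ν : ℝ) * ∏ i, x i ^ ν i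
      = (∑ i, x i) ^ n := by
  rw [Finset.sum_pow_eq_sum_piAntidiag]
  apply Finset.sum_congr _ (fun _ _ => rfl)
  ext ν; simp [Finset.Nat.mem_antidiagonalTuple]

lemma aux_tail {m n : ℕ} (hn : 0 < n) (φ : Fin m → ℝ) (hφpos : ∀ i, 0 < φ i) (hφ1 : ∑ i, φ i = 1)
    (θ : ℝ) (hθ0 : 0 < θ) :
    ∑ ν ∈ (Finset.Nat.antidiagonalTuple m n).filter (fun ν => (∑ i, |(ν i : ℝ) / n - φ i|) > θ),
      (Nat.multinomial Finset.univ ν : ℝ) * ∏ i, φ i ^ ν i ≤ 2 ^ m * Real.exp (-(n * θ ^ 2 / 2)) := by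
  have hn' : (0:ℝ) < n := by exact_mod_cast hn
  have key : ∀ S : Finset (Fin m), ∑ ν ∈ Finset.Nat.antidiagonalTuple m n,
      (Nat.multinomial Finset.univ ν : ℝ) * (∏ i, φ i ^ ν i) *
        (Real.exp (2 * θ * ∑ i ∈ S, ((ν i : ℝ) - n * φ i)) * Real.exp (-(n * θ ^ 2)))
      ≤ Real.exp (-(n * θ ^ 2 / 2)) := by
    intro S
    set p := ∑ i ∈ S, φ i with hp
    have hp0 : 0 ≤ p := Finset.sum_nonneg fun i _ => (hφpos i).le
    have hpc : p + ∑ i ∈ Sᶜ, φ i = 1 := by rw [hp, Finset.sum_add_sum_compl, hφ1]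
    have hp1 : p ≤ 1 := by
      have : 0 ≤ ∑ i ∈ Sᶜ, φ i := Finset.sum_nonneg fun i _ => (hφpos i).le
      linarith
    have h1 : ∀ ν ∈ Finset.Nat.antidiagonalTuple m n,
      (Nat.multinomial Finset.univ ν : ℝ) * (∏ i, φ i ^ ν i) *
        (Real.exp (2 * θ * ∑ i ∈ S, ((ν i : ℝ) - n * φ i)) * Real.exp (-(n * θ ^ 2))) =
      ((Nat.multinomial Finset.univ ν : ℝ) *
        ∏ i, (φ i * (if i ∈ S then Real.exp (2 * θ) else 1)) ^ ν i) *
        (Real.exp (-(2 * θ * n * p)) * Real.exp (-(n * θ ^ 2))) := by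
      intro ν _
      have : Real.exp (2 * θ * ∑ i ∈ S, ((ν i : ℝ) - n * φ i)) =
          (∏ i, (if i ∈ S then Real.exp (2 * θ) else 1) ^ ν i) * Real.exp (-(2 * θ * n * p)) := by
        have : ∀ i, (if i ∈ S then Real.exp (2 * θ) else 1) ^ ν i =
          if i ∈ S then Real.exp (2 * θ * ν i) else 1 := by
          intro i; split_ifs
          · rw [← Real.exp_nat_mul]; congr 1; ring
          · simp
        simp_rw [this]
        rw [Finset.prod_ite_mem, Finset.univ_inter, ← Real.exp_sum, ← Real.exp_add]
        congr 1
        rw [Finset.sum_sub_distrib, ← Finset.mul_sum, ← Finset.mul_sum]; ring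
      rw [this]
      simp_rw [mul_pow]
      rw [Finset.prod_mul_distrib]
      ring
    rw [Finset.sum_congr rfl h1, ← Finset.sum_mul, aux_multi]
    have h2 : ∑ i, φ i * (if i ∈ S then Real.exp (2 * θ) else 1) = (1 - p) + p * Real.exp (2 * θ) := by
      rw [← Finset.sum_add_sum_compl S]
      have a1 : ∑ i ∈ S, φ i * (if i ∈ S then Real.exp (2 * θ) else 1) = p * Real.exp (2 * θ) := by
        rw [hp, Finset.sum_mul]; exact Finset.sum_congr rfl fun i hi => by simp [hi]
      have a2 : ∑ i ∈ Sᶜ, φ i * (if i ∈ S then Real.exp (2 * θ) else 1) = ∑ i ∈ Sᶜ, φ i := by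
        exact Finset.sum_congr rfl fun i hi => by simp [Finset.mem_compl.mp hi]
      rw [a1, a2]; linarith
    rw [h2]
    have h3 := aux_hoeff p (2 * θ) hp0 hp1
    have h4 : ((1 - p) + p * Real.exp (2 * θ)) ^ n ≤ Real.exp (n * (p * (2 * θ) + (2 * θ) ^ 2 / 8)) := by
      rw [Real.exp_nat_mul]
      exact pow_le_pow_left₀ (by have := Real.exp_pos (2 * θ); nlinarith) h3 n
    refine le_trans (mul_le_mul_of_nonneg_right h4 (by positivity)) (le_of_eq ?_)
    rw [← Real.exp_add, ← Real.exp_add]; congr 1; ring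
  have step : ∀ ν ∈ (Finset.Nat.antidiagonalTuple m n).filter
      (fun ν => (∑ i, |(ν i : ℝ) / n - φ i|) > θ),
      (Nat.multinomial Finset.univ ν : ℝ) * ∏ i, φ i ^ ν i ≤
      ∑ S : Finset (Fin m), (Nat.multinomial Finset.univ ν : ℝ) * (∏ i, φ i ^ ν i) *
        (Real.exp (2 * θ * ∑ i ∈ S, ((ν i : ℝ) - n * φ i)) * Real.exp (-(n * θ ^ 2))) := by
    intro ν hν
    rw [Finset.mem_filter, Finset.Nat.mem_antidiagonalTuple] at hν
    obtain ⟨hs, hθν⟩ := hν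
    have hP : 0 ≤ (Nat.multinomial Finset.univ ν : ℝ) * ∏ i, φ i ^ ν i :=
      mul_nonneg (by positivity) (Finset.prod_nonneg fun i _ => pow_nonneg (hφpos i).le _)
    rw [← Finset.mul_sum]
    refine le_mul_of_one_le_right hP ?_
    let S : Finset (Fin m) := Finset.univ.filter fun i => (n:ℝ) * φ i ≤ ν i
    refine le_trans ?_ (Finset.single_le_sum (f := fun S : Finset (Fin m) =>
      Real.exp (2 * θ * ∑ i ∈ S, ((ν i : ℝ) - n * φ i)) * Real.exp (-(n * θ ^ 2)))
      (fun _ _ => by positivity) (Finset.mem_univ S))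
    rw [← Real.exp_add]
    apply Real.one_le_exp
    have e0 : ∑ i, ((ν i : ℝ) - n * φ i) = 0 := by
      rw [Finset.sum_sub_distrib, ← Finset.mul_sum, hφ1]
      have : (∑ i, (ν i : ℝ)) = n := by exact_mod_cast hs
      rw [this]; ring
    have e1 : ∑ i, |(ν i : ℝ) - n * φ i| = n * ∑ i, |(ν i : ℝ) / n - φ i| := by
      rw [Finset.mul_sum]
      refine Finset.sum_congr rfl fun i _ => ?_
      rw [← abs_of_pos hn', ← abs_mul, abs_of_pos hn']; congr 1; field_simp
    rw [← Finset.sum_add_sum_compl S] at e0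
    have e2 := e1
    rw [← Finset.sum_add_sum_compl S] at e2
    have a1 : ∑ i ∈ S, |(ν i : ℝ) - n * φ i| = ∑ i ∈ S, ((ν i : ℝ) - n * φ i) :=
      Finset.sum_congr rfl fun i hi => abs_of_nonneg (by simp [S] at hi; linarith)
    have a2 : ∑ i ∈ Sᶜ, |(ν i : ℝ) - n * φ i| = -∑ i ∈ Sᶜ, ((ν i : ℝ) - n * φ i) := by
      rw [← Finset.sum_neg_distrib]
      exact Finset.sum_congr rfl fun i hi => abs_of_nonpos (by simp [S] at hi; linarith)
    rw [a1, a2] at e2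
    have e3 : n * θ ≤ n * ∑ i, |(ν i : ℝ) / n - φ i| := mul_le_mul_of_nonneg_left hθν.le hn'.le
    have e4 : n * θ ≤ 2 * ∑ i ∈ S, ((ν i : ℝ) - n * φ i) := by linarith
    nlinarith
  refine le_trans (Finset.sum_le_sum step) ?_
  rw [Finset.sum_comm]
  have : ∀ S ∈ (Finset.univ : Finset (Finset (Fin m))), ∑ ν ∈ (Finset.Nat.antidiagonalTuple m n).filter
      (fun ν => (∑ i, |(ν i : ℝ) / n - φ i|) > θ), (Nat.multinomial Finset.univ ν : ℝ) * (∏ i, φ i ^ ν i) *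
        (Real.exp (2 * θ * ∑ i ∈ S, ((ν i : ℝ) - n * φ i)) * Real.exp (-(n * θ ^ 2))) ≤
        Real.exp (-(n * θ ^ 2 / 2)) := by
    intro S _
    refine le_trans (Finset.sum_le_sum_of_subset_of_nonneg (Finset.filter_subset _ _) ?_) (key S)
    intro ν _ _
    exact mul_nonneg (mul_nonneg (by positivity)
      (Finset.prod_nonneg fun i _ => pow_nonneg (hφpos i).le _)) (by positivity)
  refine le_trans (Finset.sum_le_card_nsmul _ _ _ this) (le_of_eq ?_)
  simp

lemma aux_fact_le (k : ℕ) (hk : 0 < k) :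
    Real.log (k.factorial : ℝ) ≤ 1 + 1 / 2 * Real.log k + k * Real.log k - k := by
  obtain ⟨j, rfl⟩ : ∃ j, k = j + 1 := ⟨k - 1, by omega⟩
  have h := Stirling.log_stirlingSeq'_antitone (Nat.zero_le j)
  simp only [Function.comp, Nat.succ_eq_add_one] at h
  rw [zero_add, Stirling.log_stirlingSeq_formula, Stirling.log_stirlingSeq_formula] at h
  have hk' : ((j + 1 : ℕ) : ℝ) ≠ 0 := by positivity
  rw [Real.log_mul (by norm_num) hk', Real.log_div hk' (Real.exp_pos _).ne', Real.log_exp] at h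
  simp at h
  push_cast at *
  linarith

lemma aux_fact_ge (k : ℕ) (hk : 0 < k) :
    1 / 2 * Real.log k + k * Real.log k - k ≤ Real.log (k.factorial : ℝ) := by
  have h := Stirling.le_log_factorial_stirling hk.ne'
  have : 0 ≤ Real.log (2 * Real.pi) := Real.log_nonneg (by nlinarith [Real.pi_gt_three])
  linarith

/-- lower bound on the multinomial coefficient -/
lemma aux_multi_ge {m n : ℕ} (hm : 0 < m) (hn : 0 < n) (ν : Fin m → ℕ) (hν : ∀ i, 0 < ν i)
    (hs : ∑ i, ν i = n) :
    n * (-∑ i, ((ν i : ℝ) / n) * Real.log ((ν i : ℝ) / n)) + 1 / 2 * Real.log n - m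
      - m / 2 * (Real.log n - Real.log m) ≤ Real.log (Nat.multinomial Finset.univ ν : ℝ) := by
  have hn' : (0:ℝ) < n := by exact_mod_cast hn
  have hm' : (0:ℝ) < m := by exact_mod_cast hm
  have hsr : (∑ i, (ν i : ℝ)) = n := by exact_mod_cast hs
  have hνr : ∀ i, (0:ℝ) < ν i := fun i => by exact_mod_cast hν i
  have hspec := Nat.multinomial_spec (Finset.univ) ν
  rw [hs] at hspec
  have hlog : (∑ i, Real.log ((ν i).factorial : ℝ)) + Real.log (Nat.multinomial Finset.univ ν : ℝ) =
      Real.log (n.factorial : ℝ) := by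
    rw [← hspec]; push_cast
    rw [Real.log_mul, Real.log_prod]
    · intro i _; positivity
    · exact Finset.prod_ne_zero_iff.mpr fun i _ => by positivity
    · exact_mod_cast (Nat.multinomial_pos _ _).ne'
  have h1 := aux_fact_ge n hn
  have h2 : ∑ i, Real.log ((ν i).factorial : ℝ) ≤
      ∑ i, (1 + 1 / 2 * Real.log (ν i) + ν i * Real.log (ν i) - ν i) :=
    Finset.sum_le_sum fun i _ => aux_fact_le _ (hν i)
  have h3 : ∑ i, (1 + 1 / 2 * Real.log (ν i) + ν i * Real.log (ν i) - ν i) =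
      m + 1 / 2 * (∑ i, Real.log (ν i)) + (∑ i, ν i * Real.log (ν i)) - n := by
    rw [Finset.sum_sub_distrib, Finset.sum_add_distrib, Finset.sum_add_distrib, ← Finset.mul_sum, hsr]
    simp
  have h4 : ∑ i, Real.log (ν i) ≤ m * (Real.log n - Real.log m) := by
    have : ∀ i ∈ Finset.univ, Real.log (ν i) ≤ (Real.log n - Real.log m) + ((ν i : ℝ) * (m / n) - 1) := by
      intro i _
      have := Real.log_le_sub_one_of_pos (x := (ν i : ℝ) * (m / n)) (by have := hνr i; positivity)
      rw [Real.log_mul (hνr i).ne' (by positivity), Real.log_div hm'.ne' hn'.ne'] at this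
      linarith
    refine le_trans (Finset.sum_le_sum this) (le_of_eq ?_)
    rw [Finset.sum_add_distrib, Finset.sum_sub_distrib (f := fun i => (ν i : ℝ) * (m / n)), ← Finset.sum_mul, hsr]
    simp
    field_simp
    ring
  have h5 : n * (-∑ i, ((ν i : ℝ) / n) * Real.log ((ν i : ℝ) / n)) =
      n * Real.log n - ∑ i, ν i * Real.log (ν i) := by
    have : ∀ i ∈ Finset.univ, ((ν i : ℝ) / n) * Real.log ((ν i : ℝ) / n) =
        (ν i * Real.log (ν i)) / n - ν i * (Real.log n / n) := by
      intro i _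
      rw [Real.log_div (hνr i).ne' hn'.ne']; ring
    rw [Finset.sum_congr rfl this, Finset.sum_sub_distrib, ← Finset.sum_mul, hsr, ← Finset.sum_div]
    field_simp
    ring
  linarith

lemma aux_ent1 (x y η : ℝ) (hx : 0 < x) (hy : 0 < y) (hy1 : y ≤ 1) (hη0 : 0 < η)
    (hη : η ≤ 1 / 4) (h : |y - x| ≤ η) :
    -(x * Real.log x) + y * Real.log y ≤ -(η * Real.log η) := by
  have hL : Real.log η ≤ -1 := by
    rw [Real.log_le_iff_le_exp hη0, Real.exp_neg]
    refine hη.trans ?_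
    rw [one_div]
    exact inv_anti₀ (Real.exp_pos _) (by linarith [Real.exp_one_lt_d9])
  rw [abs_le] at h
  rcases le_or_gt x y with hxy | hxy
  · have h1 := Real.log_le_sub_one_of_pos (x := y / x) (by positivity)
    rw [Real.log_div hy.ne' hx.ne'] at h1
    have h2 : x * (Real.log y - Real.log x) ≤ y - x := by
      have := mul_le_mul_of_nonneg_left h1 hx.le
      have e : x * (y / x - 1) = y - x := by field_simp
      linarith
    have h3 : Real.log y ≤ 0 := Real.log_nonpos hy.le hy1
    have h4 : (y - x) * Real.log y ≤ 0 := mul_nonpos_of_nonneg_of_nonpos (by linarith) h3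
    nlinarith
  · set t := x - y with ht
    have ht0 : 0 < t := by linarith
    have hlx : Real.log y ≤ Real.log x := Real.log_le_log hy hxy.le
    have hlt : Real.log t ≤ Real.log x := Real.log_le_log ht0 (by linarith)
    have h1 := Real.log_le_sub_one_of_pos (x := η / t) (by positivity)
    rw [Real.log_div hη0.ne' ht0.ne'] at h1
    have h2 : t * (Real.log η - Real.log t) ≤ η - t := by
      have := mul_le_mul_of_nonneg_left h1 ht0.le
      have e : t * (η / t - 1) = η - t := by field_simp
      linarith
    have h3 : x * Real.log x = y * Real.log x + t * Real.log x := by rw [ht]; ring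
    have h4 : y * Real.log y ≤ y * Real.log x := mul_le_mul_of_nonneg_left hlx hy.le
    have h5 : t * Real.log t ≤ t * Real.log x := mul_le_mul_of_nonneg_left hlt ht0.le
    have h6 : (η - t) * Real.log η ≤ (η - t) * (-1) :=
      mul_le_mul_of_nonneg_left hL (by linarith)
    nlinarith

lemma aux_round {m n : ℕ} (hm : 2 ≤ m) (x : Fin m → ℝ) (hx : ∀ i, 0 ≤ x i) (hs : ∑ i, x i = n) :
    ∃ ν : Fin m → ℕ, ∑ i, ν i = n ∧ ∀ i, |(ν i : ℝ) - x i| ≤ ((m : ℝ) - 1) / 2 := by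
  rcases Nat.lt_or_ge 2 m with h3 | h3
  · have hm3 : (3:ℝ) ≤ m := by exact_mod_cast h3
    have hfl : ∑ i, ⌊x i⌋₊ ≤ n := by
      have : ((∑ i, ⌊x i⌋₊ : ℕ) : ℝ) ≤ n := by
        push_cast; rw [← hs]; exact Finset.sum_le_sum fun i _ => Nat.floor_le (hx i)
      exact_mod_cast this
    have hfl2 : n ≤ ∑ i, ⌊x i⌋₊ + m := by
      have : (n : ℝ) ≤ ((∑ i, ⌊x i⌋₊ + m : ℕ) : ℝ) := by
        push_cast; rw [← hs]
        calc ∑ i, x i ≤ ∑ i, ((⌊x i⌋₊ : ℝ) + 1) :=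
              Finset.sum_le_sum fun i _ => (Nat.lt_floor_add_one _).le
          _ = _ := by rw [Finset.sum_add_distrib]; simp
      exact_mod_cast this
    obtain ⟨T, _, hT⟩ := Finset.exists_subset_card_eq (s := (Finset.univ : Finset (Fin m)))
      (n := n - ∑ i, ⌊x i⌋₊) (by simp; omega)
    refine ⟨fun i => ⌊x i⌋₊ + if i ∈ T then 1 else 0, ?_, ?_⟩
    · rw [Finset.sum_add_distrib]; simp [hT]; omega
    · intro i
      have a := Nat.floor_le (hx i)
      have b := Nat.lt_floor_add_one (x i)
      rw [abs_le]
      dsimp only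
      split_ifs <;> push_cast <;> constructor <;> linarith
  · obtain rfl : m = 2 := by omega
    rw [Fin.sum_univ_two] at hs
    have h0 := hx 0
    have h1 := hx 1
    have a := Nat.floor_le (a := x 0 + 1/2) (by linarith)
    have b := Nat.lt_floor_add_one (x 0 + 1/2)
    set k := ⌊x 0 + 1/2⌋₊
    have hk : k ≤ n := by
      have : (k : ℝ) < ((n + 1 : ℕ) : ℝ) := by push_cast; linarith
      have : k < n + 1 := by exact_mod_cast this
      omega
    refine ⟨![k, n - k], by simp; omega, ?_⟩
    intro i
    fin_cases i
    · simp [abs_le]; constructor <;> norm_num <;> linarith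
    · simp [Nat.cast_sub hk, abs_le]; constructor <;> norm_num <;> linarith

lemma aux_rowNorm {k m : ℕ} (A : Matrix (Fin (k + 1)) (Fin m) ℝ) (i : Fin (k + 1)) :
    ∑ j, |A i j| ≤ rowNorm A :=
  le_ciSup (f := fun i => ∑ j, |A i j|) (Set.finite_range _).bddAbove i

lemma aux_rowNorm_pos {k m : ℕ} (A : Matrix (Fin (k + 1)) (Fin m) ℝ) (hA : A ≠ 0) :
    0 < rowNorm A := by
  obtain ⟨i, j, hij⟩ : ∃ i j, A i j ≠ 0 := by
    by_contra! h
    exact hA (by ext i j; simpa using h i j)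
  refine lt_of_lt_of_le (abs_pos.mpr hij) (le_trans ?_ (aux_rowNorm A i))
  exact Finset.single_le_sum (f := fun j => |A i j|) (fun _ _ => abs_nonneg _) (Finset.mem_univ j)

lemma aux_bmin_pos {k : ℕ} (b : Fin (k + 1) → ℝ) (hb : ∀ i, b i ≠ 0) : 0 < bAbsMin b := by
  obtain ⟨i, hi⟩ := exists_eq_ciInf_of_finite (f := fun i => |b i|)
  unfold bAbsMin
  rw [← hi]; exact abs_pos.mpr (hb i)

lemma aux_feas {k m : ℕ} (A : Matrix (Fin (k + 1)) (Fin m) ℝ) (hA : A ≠ 0) (f φ : Fin m → ℝ)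
    (t d : ℝ) (ht : ∀ j, |f j - φ j| ≤ t) (htd : t ≤ d / rowNorm A) (ht0 : 0 ≤ t)
    (i : Fin (k + 1)) : |A.mulVec f i - A.mulVec φ i| ≤ d := by
  have hR := aux_rowNorm_pos A hA
  have h1 : A.mulVec f i - A.mulVec φ i = ∑ j, A i j * (f j - φ j) := by
    simp only [Matrix.mulVec, dotProduct]
    rw [← Finset.sum_sub_distrib]
    exact Finset.sum_congr rfl fun j _ => by ring
  rw [h1]
  calc |∑ j, A i j * (f j - φ j)| ≤ ∑ j, |A i j * (f j - φ j)| := Finset.abs_sum_le_sum_abs _ _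
    _ ≤ ∑ j, |A i j| * t := Finset.sum_le_sum fun j _ => by
        rw [abs_mul]; exact mul_le_mul_of_nonneg_left (ht j) (abs_nonneg _)
    _ = (∑ j, |A i j|) * t := by rw [Finset.sum_mul]
    _ ≤ rowNorm A * t := mul_le_mul_of_nonneg_right (aux_rowNorm A i) ht0
    _ ≤ d := by rw [le_div_iff₀ hR] at htd; linarith

lemma aux_opt {m : ℕ} (φ f : Fin m → ℝ) (hφpos : ∀ i, 0 < φ i) (hφ1 : ∑ i, φ i = 1)
    (hf0 : ∀ i, 0 ≤ f i) (hf1 : ∑ i, f i = 1)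
    (h : ∀ s : ℝ, 0 < s → s < 1 →
      -∑ i, (φ i + s * (f i - φ i)) * Real.log (φ i + s * (f i - φ i))
        ≤ -∑ i, φ i * Real.log (φ i)) :
    ∑ i, φ i * Real.log (φ i) ≤ ∑ i, f i * Real.log (φ i) := by
  set K := ∑ i, (f i - φ i) ^ 2 / φ i with hK
  have hK0 : 0 ≤ K := Finset.sum_nonneg fun i _ => div_nonneg (sq_nonneg _) (hφpos i).le
  have key : ∀ s : ℝ, 0 < s → s < 1 →
      ∑ i, φ i * Real.log (φ i) ≤ ∑ i, f i * Real.log (φ i) + s * K := by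
    intro s hs0 hs1
    have h1 := h s hs0 hs1
    have h2 : ∑ i, (φ i + s * (f i - φ i)) * Real.log (φ i + s * (f i - φ i)) ≤
      ∑ i, (φ i * Real.log (φ i) + s * (f i * Real.log (φ i)) - s * (φ i * Real.log (φ i)) +
        s * (f i - φ i) + s ^ 2 * ((f i - φ i) ^ 2 / φ i)) := by
      refine Finset.sum_le_sum fun i _ => ?_
      have hp := hφpos i
      have hx : 0 < φ i + s * (f i - φ i) := by nlinarith [hf0 i, mul_pos hp (sub_pos.mpr hs1), mul_nonneg hs0.le (hf0 i)]
      have h3 := Real.log_le_sub_one_of_pos (div_pos hx hp)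
      rw [Real.log_div hx.ne' hp.ne'] at h3
      have h4 := mul_le_mul_of_nonneg_left h3 hx.le
      have e : (φ i + s * (f i - φ i)) * ((φ i + s * (f i - φ i)) / φ i - 1) =
        s * (f i - φ i) + s ^ 2 * ((f i - φ i) ^ 2 / φ i) := by field_simp; ring
      rw [e] at h4
      linarith
    rw [Finset.sum_add_distrib, Finset.sum_add_distrib, Finset.sum_sub_distrib,
      Finset.sum_add_distrib, ← Finset.mul_sum, ← Finset.mul_sum, ← Finset.mul_sum, ← Finset.mul_sum,
      Finset.sum_sub_distrib, hφ1, hf1, ← hK] at h2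
    have h5 : 0 ≤ s * (∑ i, f i * Real.log (φ i) + s * K - ∑ i, φ i * Real.log (φ i)) := by linarith
    have := nonneg_of_mul_nonneg_right h5 hs0
    linarith
  refine le_of_forall_pos_le_add fun e he => ?_
  have hs := key (min (1/2) (e / (K + 1))) (by positivity) (lt_of_le_of_lt (min_le_left _ _) (by norm_num))
  refine hs.trans ?_
  have : min (1/2) (e / (K + 1)) * K ≤ e := by
    calc min (1/2) (e / (K + 1)) * K ≤ (e / (K + 1)) * K := mul_le_mul_of_nonneg_right (min_le_right _ _) hK0
      _ ≤ (e / (K + 1)) * (K + 1) := mul_le_mul_of_nonneg_left (by linarith) (by positivity)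
      _ = e := by field_simp
  linarith

/-- the numerical slack -/
lemma aux_num (m n : ℕ) (hm : 2 ≤ m) (hn : 100 ≤ n) :
    m * Real.log 2 + m + Real.log 0.249 ≤ ((m : ℝ) - 1) / 2 * Real.log n + m * Real.log 0.6
      + m * (0.5 * Real.log (2 * Real.pi) + 1 / 12) := by
  have hm' : (2:ℝ) ≤ m := by exact_mod_cast hm
  have h1 : Real.log 2 < 0.6931471808 := Real.log_two_lt_d9
  have h1' : 0.6931471803 < Real.log 2 := Real.log_two_gt_d9
  have h2 : Real.log 0.249 ≤ -(2 * Real.log 2) := by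
    have : Real.log 0.249 ≤ Real.log ((2 ^ 2)⁻¹) := Real.log_le_log (by norm_num) (by norm_num)
    rw [Real.log_inv, Real.log_pow] at this; push_cast at this; exact this
  have h3 : -(3/4 * Real.log 2) ≤ Real.log 0.6 := by
    have : Real.log ((2 ^ 3)⁻¹) ≤ Real.log (0.6 ^ 4) := Real.log_le_log (by norm_num) (by norm_num)
    rw [Real.log_inv, Real.log_pow, Real.log_pow] at this; push_cast at this; linarith
  have h4 : 5/2 * Real.log 2 ≤ Real.log (2 * Real.pi) := by
    have : Real.log (2 ^ 5) ≤ Real.log ((2 * Real.pi) ^ 2) := by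
      refine Real.log_le_log (by norm_num) ?_
      nlinarith [Real.pi_gt_three]
    rw [Real.log_pow, Real.log_pow] at this; push_cast at this; linarith
  have h5 : 13/2 * Real.log 2 ≤ Real.log n := by
    have : Real.log (2 ^ 13) ≤ Real.log ((n:ℝ) ^ 2) := by
      refine Real.log_le_log (by norm_num) ?_
      have : (100:ℝ) ≤ n := by exact_mod_cast hn
      nlinarith
    rw [Real.log_pow, Real.log_pow] at this; push_cast at this; linarith
  have h6 := mul_le_mul_of_nonneg_left h5 (show 0 ≤ ((m:ℝ) - 1) / 2 by linarith)
  have h7 := mul_le_mul_of_nonneg_left h3 (show 0 ≤ (m:ℝ) by linarith)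
  have h8 := mul_le_mul_of_nonneg_left h4 (show 0 ≤ (m:ℝ) by linarith)
  nlinarith [mul_le_mul_of_nonneg_left h1'.le (show 0 ≤ (m:ℝ) - 2 by linarith)]

set_option maxHeartbeats 1600000

/-- ℓ1 concentration (Theorem 2 of the paper, with `μ* = m`): for `n`
with `n ≥ 100`, `n ≥ C₁ ln n + C₂` and `n ≥ (m−1)/(2θ₀″)`, the realizations of
`A = {f ∈ F_n ∩ C(δ) : ‖f − φ*‖₁ ≤ θ}` are a fraction at least `1 − ε` of
`#A + #B`, where `B = {f ∈ F_n ∩ C₀ : ‖f − φ*‖₁ > θ}` and `C₀` is the set of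
vectors satisfying the constraints exactly. -/
theorem stmt_16 {m ke kle ke0 kle0 : ℕ} (hm : 2 ≤ m)
    (Aeq : Matrix (Fin (ke + 1)) (Fin m) ℝ) (beq : Fin (ke + 1) → ℝ)
    (Ale : Matrix (Fin (kle + 1)) (Fin m) ℝ) (ble : Fin (kle + 1) → ℝ)
    (Aeq0 : Matrix (Fin (ke0 + 1)) (Fin m) ℝ)
    (Ale0 : Matrix (Fin (kle0 + 1)) (Fin m) ℝ)
    (hAeq : Aeq ≠ 0) (hAle : Ale ≠ 0) (hAeq0 : Aeq0 ≠ 0) (hAle0 : Ale0 ≠ 0)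
    (hbeq : ∀ i, beq i ≠ 0) (hble : ∀ i, ble i ≠ 0)
    (deq dle deq0 dle0 : ℝ)
    (hdeq : 0 < deq) (hdle : 0 < dle) (hdeq0 : 0 < deq0) (hdle0 : 0 < dle0)
    (φ : Fin m → ℝ) (hφpos : ∀ i, 0 < φ i) (hφ1 : ∑ i, φ i = 1)
    (hsat : ExactSat Aeq beq Ale ble Aeq0 Ale0 φ)
    (hopt : ∀ x : Fin m → ℝ, (∀ i, 0 ≤ x i) → ∑ i, x i = 1 →
      ExactSat Aeq beq Ale ble Aeq0 Ale0 x →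
      -∑ i, x i * Real.log (x i) ≤ -∑ i, φ i * Real.log (φ i))
    (Hs : ℝ) (hHs : Hs = -∑ i, φ i * Real.log (φ i))
    (φmin : ℝ) (hφmin : (∃ i, φ i = φmin) ∧ ∀ i, φmin ≤ φ i)
    (ε : ℝ) (hε : 0 < ε)
    (θ : ℝ) (hθ0 : 0 < θ) (hθ : θ ≤ 1 / 2)
    (α : ℝ) (hα : α ∈ Set.Ioo (0 : ℝ) 1)
    (ψ : ℝ) (hψdef : ψ = θ ^ 2 / 2 - α * θ * Real.log ((m : ℝ) / (α * θ)))
    (hψpos : 0 < ψ)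
    (θ₀ : ℝ)
    (hθ₀ : θ₀ = min (thetaInf Aeq beq Ale ble Aeq0 Ale0 deq dle deq0 dle0)
        (α * θ / m))
    (hθ₀lt : θ₀ < φmin)
    (C₁ C₂ : ℝ)
    (hC₁ : C₁ = ((m : ℝ) - 1) / ψ)
    (hC₂ : C₂ = ((m : ℝ) * Real.log 0.6 +
        (0.5 * Real.log (2 * Real.pi) + 1 / 12 - 0.5 * Real.log (m : ℝ)) * (m : ℝ) +
        Real.log ((1 / ε + 1) / 0.249)) / ψ)
    (n : ℕ) (hn100 : 100 ≤ n)
    (hnlog : C₁ * Real.log (n : ℝ) + C₂ ≤ (n : ℝ))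
    (hnθ₀ : ((m : ℝ) - 1) / (2 * θ₀) ≤ (n : ℝ)) :
    1 - ε ≤
      (∑ ν ∈ (Finset.Nat.antidiagonalTuple m n).filter
          (fun ν => InC Aeq beq Ale ble Aeq0 Ale0 deq dle deq0 dle0
              (fun i => (ν i : ℝ) / n) ∧
            (∑ i, |(ν i : ℝ) / n - φ i|) ≤ θ),
          (Nat.multinomial Finset.univ ν : ℝ)) /
      ((∑ ν ∈ (Finset.Nat.antidiagonalTuple m n).filter
          (fun ν => InC Aeq beq Ale ble Aeq0 Ale0 deq dle deq0 dle0
              (fun i => (ν i : ℝ) / n) ∧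
            (∑ i, |(ν i : ℝ) / n - φ i|) ≤ θ),
          (Nat.multinomial Finset.univ ν : ℝ)) +
       (∑ ν ∈ (Finset.Nat.antidiagonalTuple m n).filter
          (fun ν => ExactSat Aeq beq Ale ble Aeq0 Ale0 (fun i => (ν i : ℝ) / n) ∧
            (∑ i, |(ν i : ℝ) / n - φ i|) > θ),
          (Nat.multinomial Finset.univ ν : ℝ))) := by
  have hm' : (2:ℝ) ≤ m := by exact_mod_cast hm
  have hm0 : (0:ℝ) < m := by linarith
  have hn0 : 0 < n := by omega
  have hn' : (0:ℝ) < n := by exact_mod_cast hn0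
  obtain ⟨hα0, hα1⟩ := hα
  obtain ⟨_, hφmin⟩ := hφmin
  have hφle : ∀ i, φ i ≤ 1 := fun i => by
    rw [← hφ1]; exact Finset.single_le_sum (fun j _ => (hφpos j).le) (Finset.mem_univ i)
  set η := α * θ / m with hη
  have hη0 : 0 < η := by positivity
  have hαθ : α * θ ≤ 1 / 2 := by nlinarith
  have hη4 : η ≤ 1 / 4 := by
    rw [hη, div_le_iff₀ hm0]; linarith
  have hT : 0 < thetaInf Aeq beq Ale ble Aeq0 Ale0 deq dle deq0 dle0 := by
    have := aux_rowNorm_pos Aeq hAeq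
    have := aux_rowNorm_pos Ale hAle
    have := aux_rowNorm_pos Aeq0 hAeq0
    have := aux_rowNorm_pos Ale0 hAle0
    have := aux_bmin_pos beq hbeq
    have := aux_bmin_pos ble hble
    unfold thetaInf
    positivity
  have hθ₀0 : 0 < θ₀ := by rw [hθ₀]; exact lt_min hT hη0
  have hθ₀T : θ₀ ≤ thetaInf Aeq beq Ale ble Aeq0 Ale0 deq dle deq0 dle0 := by
    rw [hθ₀]; exact min_le_left _ _
  have hθ₀η : θ₀ ≤ η := by rw [hθ₀]; exact min_le_right _ _
  -- the rounded vector
  obtain ⟨ν, hνs, hνx⟩ := aux_round (n := n) hm (fun i => n * φ i)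
    (fun i => mul_nonneg hn'.le (hφpos i).le) (by rw [← Finset.mul_sum, hφ1, mul_one])
  have hclose : ∀ i, |(ν i : ℝ) / n - φ i| ≤ θ₀ := by
    intro i
    have h1 : (ν i : ℝ) / n - φ i = ((ν i : ℝ) - n * φ i) / n := by field_simp
    rw [h1, abs_div, abs_of_pos hn', div_le_iff₀ hn']
    refine (hνx i).trans ?_
    rw [div_le_iff₀ (by positivity)] at hnθ₀
    linarith
  have hνpos : ∀ i, 0 < ν i := by
    intro i
    have h1 := (abs_le.mp (hclose i)).1
    have h2 : 0 < (ν i : ℝ) / n := by linarith [hφmin i]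
    have h3 : (0:ℝ) < ν i := by
      by_contra hc
      have : (ν i : ℝ) / n ≤ 0 := div_nonpos_of_nonpos_of_nonneg (by linarith) hn'.le
      linarith
    exact_mod_cast h3
  have hνle : ∀ i, (ν i : ℝ) / n ≤ 1 := by
    intro i
    rw [div_le_one hn']
    have : ν i ≤ n := by rw [← hνs]; exact Finset.single_le_sum (fun _ _ => Nat.zero_le _) (Finset.mem_univ i)
    exact_mod_cast this
  have hT1 : θ₀ ≤ deq * bAbsMin beq / rowNorm Aeq :=
    hθ₀T.trans ((min_le_left _ _).trans (min_le_left _ _))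
  have hT2 : θ₀ ≤ dle * bAbsMin ble / rowNorm Ale :=
    hθ₀T.trans ((min_le_left _ _).trans (min_le_right _ _))
  have hT3 : θ₀ ≤ deq0 / rowNorm Aeq0 :=
    hθ₀T.trans ((min_le_right _ _).trans (min_le_left _ _))
  have hT4 : θ₀ ≤ dle0 / rowNorm Ale0 :=
    hθ₀T.trans ((min_le_right _ _).trans (min_le_right _ _))
  obtain ⟨s1, s2, s3, s4⟩ := hsat
  have hνC : InC Aeq beq Ale ble Aeq0 Ale0 deq dle deq0 dle0 (fun i => (ν i : ℝ) / n) := by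
    refine ⟨fun i => ?_, fun i => ?_, fun i => ?_, fun i => ?_⟩
    · have := aux_feas Aeq hAeq (fun i => (ν i : ℝ) / n) φ θ₀ _ hclose hT1 hθ₀0.le i
      rwa [s1] at this
    · have := (abs_le.mp (aux_feas Ale hAle (fun i => (ν i : ℝ) / n) φ θ₀ _ hclose hT2 hθ₀0.le i)).2
      linarith [s2 i]
    · have := aux_feas Aeq0 hAeq0 (fun i => (ν i : ℝ) / n) φ θ₀ _ hclose hT3 hθ₀0.le i
      rw [s3] at this
      simpa using this
    · have := (abs_le.mp (aux_feas Ale0 hAle0 (fun i => (ν i : ℝ) / n) φ θ₀ _ hclose hT4 hθ₀0.le i)).2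
      linarith [s4 i]
  have hν1 : (∑ i, |(ν i : ℝ) / n - φ i|) ≤ θ := by
    calc (∑ i, |(ν i : ℝ) / n - φ i|) ≤ ∑ i : Fin m, η :=
          Finset.sum_le_sum fun i _ => (hclose i).trans hθ₀η
      _ = α * θ := by simp [hη]; field_simp
      _ ≤ θ := by nlinarith
  set SA := ∑ ν ∈ (Finset.Nat.antidiagonalTuple m n).filter
          (fun ν => InC Aeq beq Ale ble Aeq0 Ale0 deq dle deq0 dle0
              (fun i => (ν i : ℝ) / n) ∧
            (∑ i, |(ν i : ℝ) / n - φ i|) ≤ θ),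
          (Nat.multinomial Finset.univ ν : ℝ) with hSA
  set SB := ∑ ν ∈ (Finset.Nat.antidiagonalTuple m n).filter
          (fun ν => ExactSat Aeq beq Ale ble Aeq0 Ale0 (fun i => (ν i : ℝ) / n) ∧
            (∑ i, |(ν i : ℝ) / n - φ i|) > θ),
          (Nat.multinomial Finset.univ ν : ℝ) with hSB
  have hA1 : (Nat.multinomial Finset.univ ν : ℝ) ≤ SA :=
    Finset.single_le_sum (f := fun ν : Fin m → ℕ => (Nat.multinomial Finset.univ ν : ℝ))
      (fun _ _ => by positivity)
      (by rw [Finset.mem_filter, Finset.Nat.mem_antidiagonalTuple]; exact ⟨hνs, hνC, hν1⟩)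
  have hMpos : (0:ℝ) < (Nat.multinomial Finset.univ ν : ℝ) := by
    exact_mod_cast Nat.multinomial_pos _ _
  have hSB0 : 0 ≤ SB := Finset.sum_nonneg fun _ _ => by positivity
  -- entropy of the rounded vector
  have hent : Hs - α * θ * Real.log ((m : ℝ) / (α * θ)) ≤
      -∑ i, ((ν i : ℝ) / n) * Real.log ((ν i : ℝ) / n) := by
    have h1 : ∑ i, (-(φ i * Real.log (φ i)) + ((ν i : ℝ) / n) * Real.log ((ν i : ℝ) / n)) ≤
        ∑ i : Fin m, -(η * Real.log η) := by
      refine Finset.sum_le_sum fun i _ => aux_ent1 _ _ η (hφpos i) ?_ (hνle i) hη0 hη4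
        ((hclose i).trans hθ₀η)
      have : (0:ℝ) < ν i := by exact_mod_cast hνpos i
      positivity
    rw [Finset.sum_add_distrib, Finset.sum_neg_distrib] at h1
    have h2 : ∑ i : Fin m, -(η * Real.log η) = α * θ * Real.log ((m : ℝ) / (α * θ)) := by
      have e1 : (m : ℝ) / (α * θ) = η⁻¹ := by rw [hη, inv_div]
      have e2 : α * θ = m * η := by rw [hη]; field_simp
      rw [e1, Real.log_inv, e2]; simp; ring
    rw [h2] at h1
    linarith
  have hAlog := aux_multi_ge (by omega) hn0 ν hνpos hνs
  -- upper bound on B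
  have hB : SB ≤ 2 ^ m * Real.exp (-(n * θ ^ 2 / 2)) * Real.exp (n * Hs) := by
    refine le_trans ?_ (mul_le_mul_of_nonneg_right (aux_tail hn0 φ hφpos hφ1 θ hθ0) (Real.exp_pos _).le)
    rw [Finset.sum_mul, hSB]
    refine le_trans ?_ (Finset.sum_le_sum_of_subset_of_nonneg
      (s := (Finset.Nat.antidiagonalTuple m n).filter
          (fun ν => ExactSat Aeq beq Ale ble Aeq0 Ale0 (fun i => (ν i : ℝ) / n) ∧
            (∑ i, |(ν i : ℝ) / n - φ i|) > θ)) ?_ ?_)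
    · refine Finset.sum_le_sum fun κ hκ => ?_
      rw [Finset.mem_filter, Finset.Nat.mem_antidiagonalTuple] at hκ
      obtain ⟨hκs, ⟨t1, t2, t3, t4⟩, _⟩ := hκ
      have hκ1 : ∑ i, (κ i : ℝ) / n = 1 := by
        rw [← Finset.sum_div]
        have : (∑ i, (κ i : ℝ)) = n := by exact_mod_cast hκs
        rw [this]; field_simp
      have hκ0 : ∀ i, 0 ≤ (κ i : ℝ) / n := fun i => by positivity
      have hopt' := aux_opt φ (fun i => (κ i : ℝ) / n) hφpos hφ1 hκ0 hκ1 (by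
        intro s hs0 hs1
        refine hopt (fun i => φ i + s * ((κ i : ℝ) / n - φ i)) (fun i => ?_) ?_ ?_
        · have w1 := mul_nonneg hs0.le (hκ0 i)
          have w2 := mul_pos (hφpos i) (sub_pos.mpr hs1)
          have w3 : φ i + s * ((κ i : ℝ) / n - φ i) = s * ((κ i : ℝ) / n) + φ i * (1 - s) := by ring
          rw [w3]; exact add_nonneg w1 w2.le
        · rw [Finset.sum_add_distrib, ← Finset.mul_sum, Finset.sum_sub_distrib, hκ1, hφ1]; ring
        · have hx : (fun i => φ i + s * ((κ i : ℝ) / n - φ i)) =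
              (1 - s) • φ + s • (fun i => (κ i : ℝ) / n) := by
            ext i; simp; ring
          rw [hx]
          refine ⟨?_, fun i => ?_, ?_, fun i => ?_⟩
          · rw [Matrix.mulVec_add, Matrix.mulVec_smul, Matrix.mulVec_smul, s1, t1, ← add_smul]; simp
          · rw [Matrix.mulVec_add, Matrix.mulVec_smul, Matrix.mulVec_smul]
            simp only [Pi.add_apply, Pi.smul_apply, smul_eq_mul]
            have := mul_le_mul_of_nonneg_left (s2 i) (sub_pos.mpr hs1).le
            have := mul_le_mul_of_nonneg_left (t2 i) hs0.le
            linarith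
          · rw [Matrix.mulVec_add, Matrix.mulVec_smul, Matrix.mulVec_smul, s3, t3]; simp
          · rw [Matrix.mulVec_add, Matrix.mulVec_smul, Matrix.mulVec_smul]
            simp only [Pi.add_apply, Pi.smul_apply, smul_eq_mul]
            have := mul_le_mul_of_nonneg_left (s4 i) (sub_pos.mpr hs1).le
            have := mul_le_mul_of_nonneg_left (t4 i) hs0.le
            linarith)
      have hprod : ∏ i, φ i ^ κ i = Real.exp (n * ∑ i, (κ i : ℝ) / n * Real.log (φ i)) := by
        rw [Finset.mul_sum, Real.exp_sum]
        refine Finset.prod_congr rfl fun i _ => ?_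
        have : (n:ℝ) * ((κ i : ℝ) / n * Real.log (φ i)) = κ i * Real.log (φ i) := by field_simp
        rw [this, Real.exp_nat_mul, Real.exp_log (hφpos i)]
      rw [hprod, mul_assoc, ← Real.exp_add]
      refine le_mul_of_one_le_right (by positivity) (Real.one_le_exp ?_)
      rw [← mul_add]
      refine mul_nonneg hn'.le ?_
      rw [hHs]
      linarith
    · intro κ hκ
      rw [Finset.mem_filter] at hκ ⊢
      exact ⟨hκ.1, hκ.2.2⟩
    · intro κ _ _
      exact mul_nonneg (mul_nonneg (by positivity)
        (Finset.prod_nonneg fun i _ => pow_nonneg (hφpos i).le _)) (Real.exp_pos _).le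
  -- combine
  have hBA : SB * (1 / ε + 1) ≤ SA := by
    refine le_trans (mul_le_mul_of_nonneg_right hB (by positivity)) (le_trans ?_ hA1)
    have hE : (0:ℝ) < 1 / ε + 1 := by positivity
    rw [← Real.log_le_log_iff (by positivity) hMpos, Real.log_mul (by positivity) hE.ne',
      Real.log_mul (by positivity) (Real.exp_pos _).ne', Real.log_mul (by positivity) (Real.exp_pos _).ne',
      Real.log_exp, Real.log_exp, Real.log_pow]
    refine le_trans ?_ hAlog
    have h1 := mul_le_mul_of_nonneg_left hent hn'.le
    have h2 : ((m : ℝ) - 1) * Real.log n + ((m : ℝ) * Real.log 0.6 +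
        (0.5 * Real.log (2 * Real.pi) + 1 / 12 - 0.5 * Real.log (m : ℝ)) * (m : ℝ) +
        Real.log ((1 / ε + 1) / 0.249)) ≤ n * ψ := by
      rw [hC₁, hC₂] at hnlog
      rw [← div_le_iff₀ hψpos]
      refine le_trans (le_of_eq ?_) hnlog
      ring
    rw [Real.log_div hE.ne' (by norm_num), hψdef] at h2
    have h3 := aux_num m n hm hn100
    linarith
  have hSA0 : 0 < SA := lt_of_lt_of_le hMpos hA1
  rw [le_div_iff₀ (by linarith)]
  have h1 : SB * (1 / ε) ≤ SA := by linarith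
  have h2 : SB ≤ SA * ε := by
    have := mul_le_mul_of_nonneg_right h1 hε.le
    have e : SB * (1 / ε) * ε = SB := by field_simp
    linarith
  nlinarith [mul_nonneg hε.le hSB0]
end

section
/- Let m ≥ 2 be an integer, ε > 0, 0 < θ ≤ min(0.09, 1/m), and α ∈ (0,1) with ψ(α,θ) = θ²/2 − α·θ·ln(m/(α·θ)) > 0. Let u = (1/m, …, 1/m) ∈ ℝ^m, and define C₁ = (m−1)/ψ(α,θ) and C₂ = (m·ln 0.6 + (0.5·ln(2π) + 1/12 − 0.5·ln m)·m + ln((1/ε + 1)/0.249))/ψ(α,θ). Let n be an integer with n ≥ 100, n > m, n ≥ C₁·ln n + C₂, and n ≥ 3m/(4·α·θ), and let u* ∈ F_n satisfy ‖u* − u‖∞ ≤ 1/n and ‖u* − u‖₁ ≤ 3m/(4n) (such u* exists by rounding and adjusting n·u). Then ‖u* − u‖₁ ≤ α·θ and #u* > (1/ε)·#{p ∈ F_n : ‖p − u‖₁ > θ}. -/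
open BigOperators Finset

/-- Hoeffding's lemma for a Bernoulli variable. -/
lemma hoeffding_bernoulli (q : ℝ) (hq0 : 0 ≤ q) (hq1 : q ≤ 1) (t : ℝ) :
    q * Real.exp t + (1 - q) ≤ Real.exp (t * q + t ^ 2 / 8) := by
  let μ : MeasureTheory.Measure ℝ :=
    ENNReal.ofReal q • MeasureTheory.Measure.dirac 1 +
      ENNReal.ofReal (1 - q) • MeasureTheory.Measure.dirac 0
  have hμ : MeasureTheory.IsProbabilityMeasure μ := by
    constructor
    simp only [μ, MeasureTheory.Measure.add_apply, MeasureTheory.Measure.smul_apply,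
      MeasureTheory.measure_univ, smul_eq_mul, mul_one]
    rw [← ENNReal.ofReal_add hq0 (by linarith)]
    simp
  have hint : ∀ f : ℝ → ℝ, ∫ x, f x ∂μ = q * f 1 + (1 - q) * f 0 := by
    intro f
    have h1 : MeasureTheory.Integrable f
        (ENNReal.ofReal q • MeasureTheory.Measure.dirac (1 : ℝ)) :=
      (MeasureTheory.integrable_dirac (by simp)).smul_measure ENNReal.ofReal_ne_top
    have h2 : MeasureTheory.Integrable f
        (ENNReal.ofReal (1 - q) • MeasureTheory.Measure.dirac (0 : ℝ)) :=
      (MeasureTheory.integrable_dirac (by simp)).smul_measure ENNReal.ofReal_ne_top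
    rw [MeasureTheory.integral_add_measure h1 h2, MeasureTheory.integral_smul_measure,
      MeasureTheory.integral_smul_measure, MeasureTheory.integral_dirac,
      MeasureTheory.integral_dirac, ENNReal.toReal_ofReal hq0,
      ENNReal.toReal_ofReal (by linarith)]
    simp
  have hb : ∀ᵐ x ∂μ, (x : ℝ) ∈ Set.Icc (0 : ℝ) 1 := by
    simp only [μ]
    rw [MeasureTheory.ae_add_measure_iff]
    constructor
    · apply MeasureTheory.Measure.ae_smul_measure
      rw [MeasureTheory.ae_dirac_eq]
      simp
    · apply MeasureTheory.Measure.ae_smul_measure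
      rw [MeasureTheory.ae_dirac_eq]
      simp
  have h := (ProbabilityTheory.hasSubgaussianMGF_of_mem_Icc (X := fun x : ℝ => x)
    (μ := μ) aemeasurable_id hb).mgf_le t
  rw [ProbabilityTheory.mgf, hint, hint] at h
  have e1 : Real.exp (t * q + t ^ 2 / 8) = Real.exp (t * q) * Real.exp (t ^ 2 / 8) :=
    Real.exp_add _ _
  rw [e1]
  have e2 : t * (1 - (q * 1 + (1 - q) * 0)) = t + -(t * q) := by ring
  have e3 : t * (0 - (q * 1 + (1 - q) * 0)) = -(t * q) := by ring
  rw [e2, e3, Real.exp_add] at h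
  have e4 : (((‖(1 : ℝ) - 0‖₊ / 2) ^ 2 : NNReal) : ℝ) * t ^ 2 / 2 = t ^ 2 / 8 := by
    simp; ring
  rw [e4] at h
  have e5 : Real.exp (t * q) * Real.exp (-(t * q)) = 1 := by
    rw [← Real.exp_add]; simp
  have h6 := mul_le_mul_of_nonneg_left h (Real.exp_pos (t * q)).le
  calc q * Real.exp t + (1 - q)
      = (q * Real.exp t + (1 - q)) * (Real.exp (t * q) * Real.exp (-(t * q))) := by
        rw [e5, mul_one]
    _ = _ := by ring
    _ ≤ _ := h6

lemma multinomial_thm (m n : ℕ) (x : Fin m → ℝ) :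
    ∑ ρ ∈ Finset.Nat.antidiagonalTuple m n,
      (Nat.multinomial Finset.univ ρ : ℝ) * ∏ i, x i ^ ρ i = (∑ i, x i) ^ n := by
  rw [Finset.sum_pow_eq_sum_piAntidiag, Finset.piAntidiag_univ_fin_eq_antidiagonalTuple]

lemma chernoff_set (m n : ℕ) (hm : 0 < m) (A : Finset (Fin m)) (t : ℝ) :
    ∑ ρ ∈ Finset.Nat.antidiagonalTuple m n,
      (Nat.multinomial Finset.univ ρ : ℝ) *
        Real.exp (t * ∑ i ∈ A, ((ρ i : ℝ) - n / m))
      ≤ (m : ℝ) ^ n * Real.exp (n * (t ^ 2 / 8)) := by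
  have hm' : (0 : ℝ) < m := by exact_mod_cast hm
  set q : ℝ := (A.card : ℝ) / m with hq
  have hcard : A.card ≤ m := by simpa using A.card_le_univ
  have hq0 : 0 ≤ q := by positivity
  have hq1 : q ≤ 1 := by
    rw [hq, div_le_one hm']; exact_mod_cast hcard
  have hA : (A.card : ℝ) = m * q := by rw [hq]; field_simp
  have hH := hoeffding_bernoulli q hq0 hq1 t
  have hsum : ∑ i : Fin m, (if i ∈ A then Real.exp t else 1) = m * (q * Real.exp t + (1 - q)) := by
    have : ∀ i : Fin m, (if i ∈ A then Real.exp t else 1)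
        = (if i ∈ A then (Real.exp t - 1) else 0) + 1 := by
      intro i; split_ifs <;> ring
    rw [Finset.sum_congr rfl (fun i _ => this i), Finset.sum_add_distrib, Finset.sum_ite_mem]
    simp [hA]; ring
  have hterm : ∀ ρ : Fin m → ℕ, Real.exp (t * ∑ i ∈ A, ((ρ i : ℝ) - n / m))
      = Real.exp (-(n * (t * q))) * ∏ i, (if i ∈ A then Real.exp t else 1) ^ ρ i := by
    intro ρ
    have h1 : ∏ i, (if i ∈ A then Real.exp t else 1) ^ ρ i
        = ∏ i, (if i ∈ A then Real.exp (t * ρ i) else 1) := by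
      apply Finset.prod_congr rfl
      intro i _
      split_ifs
      · rw [mul_comm, Real.exp_nat_mul]
      · simp
    rw [h1, Finset.prod_ite_mem, Finset.univ_inter, ← Real.exp_sum, ← Real.exp_add]
    congr 1
    rw [Finset.sum_sub_distrib, ← Finset.mul_sum]
    simp only [Finset.sum_const, nsmul_eq_mul]
    rw [hA]; field_simp; ring
  calc _ = Real.exp (-(n * (t * q))) * ∑ ρ ∈ Finset.Nat.antidiagonalTuple m n,
      (Nat.multinomial Finset.univ ρ : ℝ) * ∏ i, (if i ∈ A then Real.exp t else 1) ^ ρ i := by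
        rw [Finset.mul_sum]
        apply Finset.sum_congr rfl
        intro ρ _
        rw [hterm]; ring
    _ = Real.exp (-(n * (t * q))) * (m * (q * Real.exp t + (1 - q))) ^ n := by
        rw [multinomial_thm m n (fun i => if i ∈ A then Real.exp t else 1), hsum]
    _ ≤ Real.exp (-(n * (t * q))) * (m * Real.exp (t * q + t ^ 2 / 8)) ^ n := by
        have h0 : 0 ≤ q * Real.exp t + (1 - q) :=
          add_nonneg (mul_nonneg hq0 (Real.exp_pos t).le) (by linarith)
        apply mul_le_mul_of_nonneg_left _ (Real.exp_pos _).le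
        exact pow_le_pow_left₀ (mul_nonneg hm'.le h0) (mul_le_mul_of_nonneg_left hH hm'.le) n
    _ = (m : ℝ) ^ n * Real.exp (n * (t ^ 2 / 8)) := by
        rw [mul_pow, ← Real.exp_nat_mul, mul_left_comm, ← Real.exp_add]
        congr 2; ring

lemma tail_bound (m n : ℕ) (hm : 0 < m) (hn : 0 < n) (θ : ℝ) (hθ : 0 < θ) :
    ∑ ρ ∈ (Finset.Nat.antidiagonalTuple m n).filter
        (fun ρ => (∑ i, |(ρ i : ℝ) / n - 1 / (m : ℝ)|) > θ),
        (Nat.multinomial Finset.univ ρ : ℝ)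
      ≤ 2 ^ m * ((m : ℝ) ^ n * Real.exp (-(n * (θ ^ 2 / 2)))) := by
  have hm' : (0 : ℝ) < m := by exact_mod_cast hm
  have hn' : (0 : ℝ) < n := by exact_mod_cast hn
  have key : ∀ ρ ∈ (Finset.Nat.antidiagonalTuple m n).filter
        (fun ρ => (∑ i, |(ρ i : ℝ) / n - 1 / (m : ℝ)|) > θ),
        (Nat.multinomial Finset.univ ρ : ℝ) ≤ ∑ A : Finset (Fin m),
          (Nat.multinomial Finset.univ ρ : ℝ) *
            Real.exp (2 * θ * ∑ i ∈ A, ((ρ i : ℝ) - n / m)) * Real.exp (-(n * θ ^ 2)) := by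
    intro ρ hρ
    rw [Finset.mem_filter, Finset.Nat.mem_antidiagonalTuple] at hρ
    obtain ⟨hs, hl⟩ := hρ
    let A : Finset (Fin m) := Finset.univ.filter (fun i => 0 ≤ (ρ i : ℝ) - n / m)
    have hzero : ∑ i, ((ρ i : ℝ) - n / m) = 0 := by
      rw [Finset.sum_sub_distrib]
      have : ∑ i, (ρ i : ℝ) = n := by exact_mod_cast hs
      rw [this]; simp; field_simp; ring
    have habs : ∑ i, |(ρ i : ℝ) / n - 1 / (m : ℝ)| = (∑ i, |(ρ i : ℝ) - n / m|) / n := by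
      rw [Finset.sum_div]
      apply Finset.sum_congr rfl
      intro i _
      have : (ρ i : ℝ) / n - 1 / (m : ℝ) = ((ρ i : ℝ) - n / m) / n := by field_simp
      rw [this, abs_div, abs_of_pos hn']
    have h2 : ∑ i, |(ρ i : ℝ) - n / m| = 2 * ∑ i ∈ A, ((ρ i : ℝ) - n / m) := by
      have : ∑ i, |(ρ i : ℝ) - n / m|
          = 2 * ∑ i ∈ A, ((ρ i : ℝ) - n / m) - ∑ i, ((ρ i : ℝ) - n / m) := by
        rw [Finset.sum_filter, Finset.mul_sum, ← Finset.sum_sub_distrib]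
        apply Finset.sum_congr rfl
        intro i _
        split_ifs with h
        · rw [abs_of_nonneg h]; ring
        · rw [abs_of_neg (not_le.mp h)]; ring
      rw [this, hzero, sub_zero]
    have h3 : n * θ < 2 * ∑ i ∈ A, ((ρ i : ℝ) - n / m) := by
      rw [habs, h2, gt_iff_lt, lt_div_iff₀ hn'] at hl
      linarith
    have h4 : (1 : ℝ) ≤ Real.exp (2 * θ * ∑ i ∈ A, ((ρ i : ℝ) - n / m)) *
        Real.exp (-(n * θ ^ 2)) := by
      rw [← Real.exp_add]
      apply Real.one_le_exp
      nlinarith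
    have h5 := Finset.single_le_sum (f := fun A : Finset (Fin m) =>
          (Nat.multinomial Finset.univ ρ : ℝ) *
            Real.exp (2 * θ * ∑ i ∈ A, ((ρ i : ℝ) - n / m)) * Real.exp (-(n * θ ^ 2)))
          (fun B _ => by positivity) (Finset.mem_univ A)
    refine le_trans ?_ h5
    have h6 : (0 : ℝ) ≤ (Nat.multinomial Finset.univ ρ : ℝ) := by positivity
    rw [mul_assoc]
    exact le_mul_of_one_le_right h6 h4
  calc _ ≤ _ := Finset.sum_le_sum key
    _ ≤ ∑ ρ ∈ Finset.Nat.antidiagonalTuple m n, ∑ A : Finset (Fin m),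
          (Nat.multinomial Finset.univ ρ : ℝ) *
            Real.exp (2 * θ * ∑ i ∈ A, ((ρ i : ℝ) - n / m)) * Real.exp (-(n * θ ^ 2)) := by
        apply Finset.sum_le_sum_of_subset_of_nonneg (Finset.filter_subset _ _)
        intro ρ _ _
        positivity
    _ = ∑ A : Finset (Fin m), (∑ ρ ∈ Finset.Nat.antidiagonalTuple m n,
          (Nat.multinomial Finset.univ ρ : ℝ) *
            Real.exp (2 * θ * ∑ i ∈ A, ((ρ i : ℝ) - n / m))) * Real.exp (-(n * θ ^ 2)) := by
        rw [Finset.sum_comm]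
        simp_rw [Finset.sum_mul]
    _ ≤ ∑ A : Finset (Fin m), ((m : ℝ) ^ n * Real.exp (n * ((2 * θ) ^ 2 / 8))) *
          Real.exp (-(n * θ ^ 2)) := by
        apply Finset.sum_le_sum
        intro A _
        exact mul_le_mul_of_nonneg_right (chernoff_set m n hm A (2 * θ)) (Real.exp_pos _).le
    _ = _ := by
        rw [mul_assoc, ← Real.exp_add]
        simp only [Finset.sum_const, Finset.card_univ, Fintype.card_finset, Fintype.card_fin,
          nsmul_eq_mul]
        push_cast
        congr 3; ring

lemma card_tuples (k n : ℕ) :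
    (Finset.Nat.antidiagonalTuple (k + 1) n).card ≤ (n + 1) ^ k := by
  have h := Finset.card_le_card_of_injOn (s := Finset.Nat.antidiagonalTuple (k + 1) n)
    (t := Fintype.piFinset (fun _ : Fin k => Finset.range (n + 1)))
    (fun ρ => fun i : Fin k => ρ i.succ) ?_ ?_
  · simpa using h
  · intro ρ hρ
    have hs := Finset.Nat.mem_antidiagonalTuple.mp (Finset.mem_coe.mp hρ)
    simp only [Finset.mem_coe, Fintype.mem_piFinset, Finset.mem_range]
    intro i
    have := Finset.single_le_sum (f := ρ) (fun _ _ => Nat.zero_le _) (Finset.mem_univ i.succ)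
    omega
  · intro ρ hρ σ hσ h
    have hs := Finset.Nat.mem_antidiagonalTuple.mp (Finset.mem_coe.mp hρ)
    have hs' := Finset.Nat.mem_antidiagonalTuple.mp (Finset.mem_coe.mp hσ)
    rw [Fin.sum_univ_succ] at hs hs'
    have h' : ∀ i : Fin k, ρ i.succ = σ i.succ := fun i => congrFun h i
    have h0 : ρ 0 = σ 0 := by
      have : ∑ i : Fin k, ρ i.succ = ∑ i : Fin k, σ i.succ :=
        Finset.sum_congr rfl (fun i _ => h' i)
      omega
    funext i
    refine Fin.cases h0 h' i

lemma fact_pow_le (a b : ℕ) :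
    a.factorial * a ^ b ≤ b.factorial * a ^ a := by
  rcases le_total a b with h | h
  · have := Nat.factorial_mul_pow_sub_le_factorial h
    calc a.factorial * a ^ b = a.factorial * a ^ (b - a) * a ^ a := by
          rw [mul_assoc, ← pow_add]; congr 2; omega
      _ ≤ _ := Nat.mul_le_mul_right _ this
  · obtain ⟨c, rfl⟩ := Nat.exists_eq_add_of_le h
    have := Nat.factorial_mul_pow_le_factorial (m := b) (n := c)
    have h2 : (b + c).factorial ≤ b.factorial * (b + c) ^ c := by
      clear this h
      induction c with
      | zero => simp
      | succ c ih =>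
        calc (b + (c + 1)).factorial = (b + (c + 1)) * (b + c).factorial := by
              rw [← add_assoc, Nat.factorial_succ]
          _ ≤ (b + (c + 1)) * (b.factorial * (b + c) ^ c) := Nat.mul_le_mul_left _ ih
          _ ≤ (b + (c + 1)) * (b.factorial * (b + (c + 1)) ^ c) := by gcongr; omega
          _ = _ := by ring
    calc (b + c).factorial * (b + c) ^ b ≤ b.factorial * (b + c) ^ c * (b + c) ^ b :=
          Nat.mul_le_mul_right _ h2
      _ = _ := by rw [mul_assoc, ← pow_add]; congr 2; omega

lemma mode_le (m n : ℕ) (ν ρ : Fin m → ℕ) (hν : ∑ i, ν i = n) (hρ : ∑ i, ρ i = n) :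
    Nat.multinomial Finset.univ ρ * ∏ i, ν i ^ ρ i
      ≤ Nat.multinomial Finset.univ ν * ∏ i, ν i ^ ν i := by
  have h1 := Nat.multinomial_spec Finset.univ ρ
  have h2 := Nat.multinomial_spec Finset.univ ν
  rw [hρ] at h1
  rw [hν] at h2
  have h3 : (∏ i, (ν i).factorial) * ∏ i, ν i ^ ρ i
      ≤ (∏ i, (ρ i).factorial) * ∏ i, ν i ^ ν i := by
    rw [← Finset.prod_mul_distrib, ← Finset.prod_mul_distrib]
    exact Finset.prod_le_prod' (fun i _ => fact_pow_le _ _)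
  have p1 : 0 < ∏ i, (ν i).factorial := Finset.prod_pos (fun i _ => Nat.factorial_pos _)
  have p2 : 0 < ∏ i, (ρ i).factorial := Finset.prod_pos (fun i _ => Nat.factorial_pos _)
  refine Nat.le_of_mul_le_mul_left ?_ (Nat.mul_pos p1 p2)
  set a := ∏ i, (ν i).factorial
  set b := ∏ i, (ρ i).factorial
  set M := Nat.multinomial Finset.univ ρ
  set N := Nat.multinomial Finset.univ ν
  calc a * b * (M * ∏ i, ν i ^ ρ i) = (b * M) * (a * ∏ i, ν i ^ ρ i) := by ring
    _ = (a * N) * (a * ∏ i, ν i ^ ρ i) := by rw [h1, h2]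
    _ ≤ (a * N) * (b * ∏ i, ν i ^ ν i) := Nat.mul_le_mul_left _ h3
    _ = _ := by ring

lemma mode_lower (k n : ℕ) (ν : Fin (k + 1) → ℕ) (hν : ∑ i, ν i = n) :
    (n : ℝ) ^ n ≤ (n + 1 : ℝ) ^ k * ((Nat.multinomial Finset.univ ν : ℝ) *
      ∏ i, (ν i : ℝ) ^ ν i) := by
  have h := multinomial_thm (k + 1) n (fun i => (ν i : ℝ))
  have hs : ∑ i, (ν i : ℝ) = n := by exact_mod_cast hν
  rw [hs] at h
  rw [← h]
  have hle : ∀ ρ ∈ Finset.Nat.antidiagonalTuple (k + 1) n,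
      (Nat.multinomial Finset.univ ρ : ℝ) * ∏ i, (ν i : ℝ) ^ ρ i ≤
      (Nat.multinomial Finset.univ ν : ℝ) * ∏ i, (ν i : ℝ) ^ ν i := by
    intro ρ hρ
    exact_mod_cast mode_le (k + 1) n ν ρ hν (Finset.Nat.mem_antidiagonalTuple.mp hρ)
  have h2 := Finset.sum_le_card_nsmul _ _ _ hle
  refine h2.trans ?_
  rw [nsmul_eq_mul]
  apply mul_le_mul_of_nonneg_right
  · exact_mod_cast card_tuples k n
  · positivity

lemma prod_upper (m n : ℕ) (hm : 0 < m) (hnm : m < n) (ν : Fin m → ℕ) (hν : ∑ i, ν i = n)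
    (hinf : ∀ i, |(ν i : ℝ) / n - 1 / (m : ℝ)| ≤ 1 / n)
    (hl1 : (∑ i, |(ν i : ℝ) / n - 1 / (m : ℝ)|) ≤ 3 * (m : ℝ) / (4 * n)) :
    (m : ℝ) ^ n * ∏ i, (ν i : ℝ) ^ ν i ≤ (n : ℝ) ^ n * Real.exp (3 * m / 4) := by
  have hm' : (0 : ℝ) < m := by exact_mod_cast hm
  have hnm' : (m : ℝ) < n := by exact_mod_cast hnm
  have hn' : (0 : ℝ) < n := by linarith
  have hs : ∑ i, (ν i : ℝ) = n := by exact_mod_cast hν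
  have hpw : ∀ i, (m : ℝ) ^ ν i * (ν i : ℝ) ^ ν i ≤
      (n : ℝ) ^ ν i * Real.exp (ν i * (m * ν i / n - 1)) := by
    intro i
    rw [Real.exp_nat_mul, ← mul_pow, ← mul_pow]
    apply pow_le_pow_left₀ (by positivity)
    have := Real.add_one_le_exp ((m : ℝ) * ν i / n - 1)
    calc (m : ℝ) * ν i = n * (m * ν i / n - 1 + 1) := by field_simp; ring
      _ ≤ _ := by gcongr
  have hprod := Finset.prod_le_prod (s := Finset.univ) (fun i _ => by positivity)
    (fun i _ => hpw i)
  rw [Finset.prod_mul_distrib, Finset.prod_mul_distrib, Finset.prod_pow_eq_pow_sum,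
    Finset.prod_pow_eq_pow_sum, hν, ← Real.exp_sum] at hprod
  refine hprod.trans ?_
  apply mul_le_mul_of_nonneg_left _ (by positivity)
  apply Real.exp_le_exp.mpr
  have e1 : ∑ i, (ν i : ℝ) * (m * ν i / n - 1)
      = ∑ i, ((m * n : ℝ) * ((ν i : ℝ) / n - 1 / m) ^ 2) := by
    have e2 : ∀ i, (ν i : ℝ) * (m * ν i / n - 1)
      = (m * n : ℝ) * ((ν i : ℝ) / n - 1 / m) ^ 2 + ((ν i : ℝ) - n / m) := by
      intro i; field_simp; ring
    rw [Finset.sum_congr rfl (fun i _ => e2 i), Finset.sum_add_distrib, Finset.sum_sub_distrib, hs]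
    simp; field_simp; ring
  rw [e1]
  calc ∑ i, ((m * n : ℝ) * ((ν i : ℝ) / n - 1 / m) ^ 2)
      ≤ ∑ i, (m : ℝ) * |(ν i : ℝ) / n - 1 / m| := by
        apply Finset.sum_le_sum
        intro i _
        have h := hinf i
        rw [← sq_abs]
        have h0 := abs_nonneg ((ν i : ℝ) / n - 1 / m)
        set y := |(ν i : ℝ) / n - 1 / m|
        have : n * y ≤ 1 := by
          rw [le_div_iff₀ hn'] at h; linarith
        calc (m * n : ℝ) * y ^ 2 = m * ((n * y) * y) := by ring
          _ ≤ m * (1 * y) := by gcongr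
          _ = _ := by ring
    _ = m * ∑ i, |(ν i : ℝ) / n - 1 / m| := by rw [Finset.mul_sum]
    _ ≤ m * (3 * (m : ℝ) / (4 * n)) := by gcongr
    _ ≤ 3 * m / 4 := by
        have : (m : ℝ) / n ≤ 1 := by rw [div_le_one hn']; exact hnm'.le
        calc m * (3 * (m : ℝ) / (4 * n)) = (3 * m / 4) * (m / n) := by field_simp
          _ ≤ (3 * m / 4) * 1 := by gcongr
          _ = _ := by ring

/-- The numerical inequality. -/
lemma numeric (m n : ℝ) (hm : 2 ≤ m) (hnm : m < n) (hn : 100 ≤ n) (θ α ψ ε : ℝ) (hε : 0 < ε)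
    (hθ0 : 0 < θ) (hθ : θ ≤ 0.09) (hα0 : 0 < α) (hα1 : α < 1)
    (hψ : ψ = θ ^ 2 / 2 - α * θ * Real.log (m / (α * θ)))
    (h : (m - 1) * Real.log n + (m * Real.log 0.6 +
        (0.5 * Real.log (2 * Real.pi) + 1 / 12 - 0.5 * Real.log m) * m +
        Real.log ((1 / ε + 1) / 0.249)) ≤ n * ψ)
    (hnαθ : 3 * m / (4 * α * θ) ≤ n) :
    Real.log (1 / ε) + m * Real.log 2 + 3 * m / 4 + (m - 1) * Real.log (n + 1)
      < n * (θ ^ 2 / 2) := by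
  have hn0 : 0 < n := by linarith
  have hδ : 0 < α * θ := by positivity
  have hδ1 : α * θ ≤ 0.09 := by nlinarith
  -- the mixed entropy term
  set t := n * (α * θ) with ht
  have ht0 : 0 < t := by positivity
  have hts : 3 * m / 4 ≤ t := by
    rw [div_le_iff₀ (by positivity)] at hnαθ
    rw [ht]; linarith
  have hL1 : 1 ≤ Real.log (m / (α * θ)) := by
    rw [Real.le_log_iff_exp_le (by positivity), le_div_iff₀ hδ]
    have := Real.exp_one_lt_d9
    nlinarith
  have hsplit : Real.log (4 * n / 3) = Real.log (m / (α * θ)) + Real.log (t / (3 * m / 4)) := by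
    rw [← Real.log_mul (by positivity) (by positivity)]
    congr 1
    rw [ht]; field_simp
  have hlogt : Real.log (t / (3 * m / 4)) ≤ t / (3 * m / 4) - 1 :=
    Real.log_le_sub_one_of_pos (by positivity)
  have hmix : 3 * m / 4 * Real.log (4 * n / 3) ≤ t * Real.log (m / (α * θ)) := by
    rw [hsplit]
    have h1 : 3 * m / 4 * Real.log (t / (3 * m / 4)) ≤ t - 3 * m / 4 := by
      calc _ ≤ 3 * m / 4 * (t / (3 * m / 4) - 1) := by gcongr
        _ = _ := by field_simp
    nlinarith
  have h43 : Real.log (4 * n / 3) = Real.log n + Real.log (4 / 3) := by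
    rw [← Real.log_mul (by positivity) (by positivity)]; congr 1; ring
  have l43 : 1 / 4 ≤ Real.log (4 / 3) := by
    have := Real.one_sub_inv_le_log_of_pos (x := 4 / 3) (by norm_num)
    norm_num at this ⊢; linarith
  have l2 := Real.log_two_gt_d9
  have l2' := Real.log_two_lt_d9
  have l06 : -0.5266 ≤ Real.log 0.6 := by
    have e : (0.6 : ℝ) = 1.2 / 2 := by norm_num
    rw [e, Real.log_div (by norm_num) (by norm_num)]
    have := Real.one_sub_inv_le_log_of_pos (x := 1.2) (by norm_num)
    norm_num at this ⊢; linarith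
  have lpi : 2 * Real.log 2 ≤ Real.log (2 * Real.pi) := by
    have : 2 * Real.log 2 = Real.log 4 := by
      rw [show (4 : ℝ) = 2 ^ 2 by norm_num, Real.log_pow]; norm_num
    rw [this]
    apply Real.log_le_log (by norm_num)
    have := Real.pi_gt_three; linarith
  have ln : 4.56 ≤ Real.log n := by
    have h1 : Real.log 100 ≤ Real.log n := Real.log_le_log (by norm_num) hn
    have e : (100 : ℝ) = 2 ^ 7 * (100 / 128) := by norm_num
    rw [e, Real.log_mul (by norm_num) (by norm_num), Real.log_pow] at h1
    have := Real.one_sub_inv_le_log_of_pos (x := 100 / 128) (by norm_num)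
    norm_num at this h1 ⊢; linarith
  have lmn : Real.log m ≤ Real.log n := Real.log_le_log (by linarith) hnm.le
  have ln1 : Real.log (n + 1) ≤ Real.log n + 0.01 := by
    have e : n + 1 = n * (1 + 1 / n) := by field_simp
    rw [e, Real.log_mul (by positivity) (by positivity)]
    have h1 := Real.log_le_sub_one_of_pos (x := 1 + 1 / n) (by positivity)
    have h2 : 1 / n ≤ 1 / 100 := one_div_le_one_div_of_le (by norm_num) hn
    norm_num at h1 h2 ⊢; linarith
  have lε : Real.log (1 / ε) < Real.log ((1 / ε + 1) / 0.249) := by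
    have : 0 < 1 / ε := by positivity
    apply Real.log_lt_log this
    rw [lt_div_iff₀ (by norm_num)]
    nlinarith
  have hnψ : n * ψ = n * (θ ^ 2 / 2) - t * Real.log (m / (α * θ)) := by
    rw [hψ, ht]; ring
  rw [h43] at hmix
  have hA : (m - 1) * Real.log (n + 1) ≤ (m - 1) * (Real.log n + 0.01) := by
    apply mul_le_mul_of_nonneg_left ln1; linarith
  have hB : 0 ≤ m * (Real.log 0.6 + 0.5 * Real.log (2 * Real.pi) + 1 / 12 - 0.5 * Real.log m
      + 3 / 4 * (Real.log n + Real.log (4 / 3)) - Real.log 2 - 3 / 4 - 0.01) := by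
    apply mul_nonneg (by linarith)
    norm_num at *
    linarith
  nlinarith

/-- Quantified principle of indifference. With no constraints, the
rational approximation `u* ∈ F_n` to the uniform vector `u = (1/m,…,1/m)` (obtained
by rounding and adjusting `n·u`) satisfies `‖u* − u‖₁ ≤ αθ` and has more than `1/ε`
times the realizations of the entire set of `p ∈ F_n` with `‖p − u‖₁ > θ`, provided
`ψ(α,θ) > 0`, `n ≥ 100`, `n > m`, `n ≥ C₁·ln n + C₂` and `n ≥ 3m/(4αθ)`. -/
theorem stmt_18 (m : ℕ) (hm : 2 ≤ m) (ε : ℝ) (hε : 0 < ε)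
    (θ : ℝ) (hθ0 : 0 < θ) (hθ : θ ≤ min 0.09 (1 / (m : ℝ)))
    (α : ℝ) (hα : α ∈ Set.Ioo (0 : ℝ) 1)
    (ψ : ℝ) (hψdef : ψ = θ ^ 2 / 2 - α * θ * Real.log ((m : ℝ) / (α * θ)))
    (hψpos : 0 < ψ)
    (u : Fin m → ℝ) (hu : u = fun _ => 1 / (m : ℝ))
    (C₁ C₂ : ℝ)
    (hC₁ : C₁ = ((m : ℝ) - 1) / ψ)
    (hC₂ : C₂ = ((m : ℝ) * Real.log 0.6 +
        (0.5 * Real.log (2 * Real.pi) + 1 / 12 - 0.5 * Real.log (m : ℝ)) * (m : ℝ) +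
        Real.log ((1 / ε + 1) / 0.249)) / ψ)
    (n : ℕ) (hn100 : 100 ≤ n) (hnm : m < n)
    (hnlog : C₁ * Real.log (n : ℝ) + C₂ ≤ (n : ℝ))
    (hnαθ : 3 * (m : ℝ) / (4 * α * θ) ≤ (n : ℝ))
    (ν : Fin m → ℕ) (hν : ∑ i, ν i = n)
    (hinf : ∀ i, |(ν i : ℝ) / n - u i| ≤ 1 / n)
    (hl1 : (∑ i, |(ν i : ℝ) / n - u i|) ≤ 3 * (m : ℝ) / (4 * n)) :
    (∑ i, |(ν i : ℝ) / n - u i|) ≤ α * θ ∧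
    (1 / ε) * (∑ ρ ∈ (Finset.Nat.antidiagonalTuple m n).filter
        (fun ρ => (∑ i, |(ρ i : ℝ) / n - u i|) > θ),
        (Nat.multinomial Finset.univ ρ : ℝ)) <
      (Nat.multinomial Finset.univ ν : ℝ) := by
  subst hu
  have hm' : (2 : ℝ) ≤ m := by exact_mod_cast hm
  have hm0 : (0 : ℝ) < m := by linarith
  have hn' : (100 : ℝ) ≤ n := by exact_mod_cast hn100
  have hn0 : (0 : ℝ) < n := by linarith
  have hnm' : (m : ℝ) < n := by exact_mod_cast hnm
  obtain ⟨hα0, hα1⟩ := hα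
  have hδ : 0 < α * θ := by positivity
  constructor
  · refine hl1.trans ?_
    rw [div_le_iff₀ (by positivity)] at hnαθ ⊢
    linarith
  have hlog : ((m : ℝ) - 1) * Real.log n + ((m : ℝ) * Real.log 0.6 +
        (0.5 * Real.log (2 * Real.pi) + 1 / 12 - 0.5 * Real.log (m : ℝ)) * (m : ℝ) +
        Real.log ((1 / ε + 1) / 0.249)) ≤ n * ψ := by
    rw [hC₁, hC₂, div_mul_eq_mul_div, ← add_div, div_le_iff₀ hψpos] at hnlog
    exact hnlog
  have hnum := numeric m n hm' hnm' hn' θ α ψ ε hε hθ0 (hθ.trans (min_le_left _ _)) hα0 hα1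
    hψdef hlog hnαθ
  have htail := tail_bound m n (by omega) (by omega) θ hθ0
  have hup := prod_upper m n (by omega) hnm ν hν hinf hl1
  have hlow : (n : ℝ) ^ n ≤ (n + 1 : ℝ) ^ (m - 1) * ((Nat.multinomial Finset.univ ν : ℝ) *
      ∏ i, (ν i : ℝ) ^ ν i) := by
    obtain ⟨k, rfl⟩ : ∃ k, m = k + 1 := ⟨m - 1, by omega⟩
    simpa using mode_lower k n ν hν
  set N : ℝ := (Nat.multinomial Finset.univ ν : ℝ) with hN
  have hN0 : 0 ≤ N := by positivity
  have hnn : (0 : ℝ) < (n : ℝ) ^ n := by positivity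
  have hmn : (0 : ℝ) < (m : ℝ) ^ n := by positivity
  -- lower bound for the multinomial coefficient
  have hlow2 : (m : ℝ) ^ n ≤ (n + 1 : ℝ) ^ (m - 1) * N * Real.exp (3 * m / 4) := by
    refine le_of_mul_le_mul_left ?_ hnn
    calc (n : ℝ) ^ n * (m : ℝ) ^ n
        ≤ ((n + 1 : ℝ) ^ (m - 1) * (N * ∏ i, (ν i : ℝ) ^ ν i)) * (m : ℝ) ^ n := by gcongr
      _ = ((n + 1 : ℝ) ^ (m - 1) * N) * ((m : ℝ) ^ n * ∏ i, (ν i : ℝ) ^ ν i) := by ring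
      _ ≤ ((n + 1 : ℝ) ^ (m - 1) * N) * ((n : ℝ) ^ n * Real.exp (3 * m / 4)) := by gcongr
      _ = _ := by ring
  -- exponentiate the numerical inequality
  have hexp : (1 / ε) * 2 ^ m * Real.exp (3 * m / 4) * (n + 1 : ℝ) ^ (m - 1)
      < Real.exp (n * (θ ^ 2 / 2)) := by
    have h1 := Real.exp_lt_exp.mpr hnum
    have e1 : Real.exp (Real.log (1 / ε)) = 1 / ε := Real.exp_log (by positivity)
    have e2 : Real.exp ((m : ℝ) * Real.log 2) = 2 ^ m := by
      rw [Real.exp_nat_mul, Real.exp_log (by norm_num)]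
    have e3 : Real.exp (((m : ℝ) - 1) * Real.log (n + 1)) = (n + 1 : ℝ) ^ (m - 1) := by
      have : ((m : ℝ) - 1) = ((m - 1 : ℕ) : ℝ) := by
        rw [Nat.cast_sub (by omega)]; simp
      rw [this, Real.exp_nat_mul, Real.exp_log (by positivity)]
    rwa [Real.exp_add, Real.exp_add, Real.exp_add, e1, e2, e3] at h1
  have hE : Real.exp (-(n * (θ ^ 2 / 2))) * Real.exp (n * (θ ^ 2 / 2)) = 1 := by
    rw [← Real.exp_add]; simp
  have hNpos : 0 < N := by
    rw [hN]; exact_mod_cast Nat.multinomial_pos Finset.univ ν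
  have hEp := Real.exp_pos (-(n * (θ ^ 2 / 2)))
  calc _ ≤ (1 / ε) * (2 ^ m * ((m : ℝ) ^ n * Real.exp (-(n * (θ ^ 2 / 2))))) := by
        apply mul_le_mul_of_nonneg_left _ (by positivity)
        exact htail
    _ ≤ (1 / ε) * (2 ^ m * (((n + 1 : ℝ) ^ (m - 1) * N * Real.exp (3 * m / 4)) *
          Real.exp (-(n * (θ ^ 2 / 2))))) := by gcongr
    _ = ((1 / ε) * 2 ^ m * Real.exp (3 * m / 4) * (n + 1 : ℝ) ^ (m - 1)) *
          (N * Real.exp (-(n * (θ ^ 2 / 2)))) := by ring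
    _ < Real.exp (n * (θ ^ 2 / 2)) * (N * Real.exp (-(n * (θ ^ 2 / 2)))) := by
        apply mul_lt_mul_of_pos_right hexp; positivity
    _ = N * (Real.exp (-(n * (θ ^ 2 / 2))) * Real.exp (n * (θ ^ 2 / 2))) := by ring
    _ = N := by rw [hE, mul_one]
end
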